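/- arXiv:2009.02817 — 2 statements merged into one kernel-verified Lean document; each statement's English description precedes it below -/
import Mathlib

section
/- If 𝒢 is a null upper semi-continuous decomposition of a compact metric space X each of whose non-singleton elements is recursively squeezable, then 𝒢 is strongly shrinkable, and hence the quotient map π : X → X/𝒢 is a strong near homeomorphism. -/
open Metric Set Function

universe u v

/-- A collection of subsets of a (pseudo)metric space is *null* if for every `ε > 0`
only finitely many of its members have diameter `≥ ε`. -/
def IsNullCollection {X : Type u} [PseudoMetricSpace X] (𝒞 : Set (Set X)) : Prop :=
  ∀ ε : ℝ, 0 < ε → {C | C ∈ 𝒞 ∧ ε ≤ Metric.diam C}.Finite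

/-- An upper semi-continuous decomposition of a space `X`: a partition of `X` into
nonempty compact subsets such that the quotient map to the quotient space
(with the quotient topology) is a closed map. -/
def IsUSCDecomposition {X : Type u} [TopologicalSpace X] (𝒢 : Set (Set X)) : Prop :=
  (∀ G ∈ 𝒢, IsCompact G ∧ G.Nonempty) ∧
  (∀ x : X, ∃! G, G ∈ 𝒢 ∧ x ∈ G) ∧
  IsClosedMap (Quot.mk (fun x y : X => ∃ G ∈ 𝒢, x ∈ G ∧ y ∈ G))

/-- `f` maps `S` homeomorphically onto `T`. -/
def MapsHomeomorphicallyOnto {X : Type u} {Y : Type v} [TopologicalSpace X]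
    [TopologicalSpace Y] (f : X → Y) (S : Set X) (T : Set Y) : Prop :=
  ∃ e : S ≃ₜ T, ∀ x : S, (e x : Y) = f (x : X)

/-- A compact subset `A` of a metric space `X` is *squeezable* if for every null
upper semi-continuous decomposition `𝒢` of `X` with `A ∈ 𝒢`, every open neighborhood
`U` of `A` and every `δ > 0`, there is a homeomorphism `h : X → X` which is the identity
on `X − U`, with `diam (h '' A) < δ`, and such that for every `G ∈ 𝒢` either
`diam (h '' G) < δ` or `h` is the identity on `G`. -/
def Squeezable {X : Type u} [MetricSpace X] (A : Set X) : Prop :=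
  IsCompact A ∧
    ∀ 𝒢 : Set (Set X), IsUSCDecomposition 𝒢 → IsNullCollection 𝒢 → A ∈ 𝒢 →
      ∀ U : Set X, IsOpen U → A ⊆ U → ∀ δ : ℝ, 0 < δ →
        ∃ h : X ≃ₜ X, (∀ x ∈ Uᶜ, h x = x) ∧ Metric.diam (⇑h '' A) < δ ∧
          ∀ G ∈ 𝒢, Metric.diam (⇑h '' G) < δ ∨ ∀ x ∈ G, h x = x

/-- A compact subset `A` of a metric space `X` is *squashable* if for every null
upper semi-continuous decomposition `𝒢` of `X` with `A ∈ 𝒢`, every open neighborhood `U`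
of `A` and every `δ > 0`, there is a continuous map `f : X → X` in the closure (in `C(X,X)`)
of the set of homeomorphisms of `X` fixing `X − U` pointwise, such that `f '' A` is a
one-point set `{p}`, `f` maps `X − A` homeomorphically onto `X − {p}`, and for every
`G ∈ 𝒢` either `diam (f '' G) < δ` or `f` is the identity on `G`. -/
def Squashable {X : Type u} [MetricSpace X] (A : Set X) : Prop :=
  IsCompact A ∧
    ∀ 𝒢 : Set (Set X), IsUSCDecomposition 𝒢 → IsNullCollection 𝒢 → A ∈ 𝒢 →
      ∀ U : Set X, IsOpen U → A ⊆ U → ∀ δ : ℝ, 0 < δ →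
        ∃ (f : C(X, X)) (p : X),
          f ∈ closure ((fun h : X ≃ₜ X => (h : C(X, X))) ''
              {h : X ≃ₜ X | ∀ x ∈ Uᶜ, h x = x}) ∧
          ⇑f '' A = {p} ∧
          MapsHomeomorphicallyOnto (⇑f) Aᶜ ({p}ᶜ) ∧
          ∀ G ∈ 𝒢, Metric.diam (⇑f '' G) < δ ∨ ∀ x ∈ G, f x = x

/-- `π` injects over `C` if `π` is injective on `π ⁻¹' C`. -/
def InjectsOver {X : Type u} {Y : Type v} (π : X → Y) (C : Set Y) : Prop :=
  Set.InjOn π (π ⁻¹' C)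

/-- The strong shrinking criterion for an onto map `π : X → Y` between compact metric
spaces. -/
def SatisfiesStrongShrinkingCriterion {X : Type u} {Y : Type v} [MetricSpace X]
    [MetricSpace Y] (π : X → Y) : Prop :=
  ∀ δ : ℝ, 0 < δ → ∀ C : Set Y, IsClosed C → InjectsOver π C →
    ∃ h : X ≃ₜ X,
      (∀ y : Y, Metric.diam (⇑h '' (π ⁻¹' {y})) < δ) ∧
      (∀ x : X, dist (π x) (π (h.symm x)) < δ) ∧
      ∀ x ∈ π ⁻¹' C, h x = x

/-- `π : X → Y` is a strong near homeomorphism. -/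
def IsStrongNearHomeomorphism {X : Type u} {Y : Type v} [MetricSpace X]
    [MetricSpace Y] (π : X → Y) : Prop :=
  ∀ ε : ℝ, 0 < ε → ∀ C : Set Y, IsClosed C → InjectsOver π C →
    ∃ f : X ≃ₜ Y, (∀ x : X, dist (π x) (f x) < ε) ∧ ∀ x ∈ π ⁻¹' C, f x = π x

/-- A subset of `ℝⁿ` is starlike if it is compact and contains a point `x` such that the
segment from `x` to any of its points lies in it. -/
def IsStarlike {n : ℕ} (A : Set (EuclideanSpace ℝ (Fin n))) : Prop :=
  IsCompact A ∧ ∃ x ∈ A, ∀ y ∈ A, segment ℝ x y ⊆ A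

/-- A subset `A` of a space `X` is starlike-equivalent if some open neighborhood of `A`
embeds onto an open subset of some `ℝⁿ` (`n ≥ 1`) carrying `A` onto a starlike set. -/
def IsStarlikeEquivalent {X : Type u} [TopologicalSpace X] (A : Set X) : Prop :=
  ∃ n : ℕ, 1 ≤ n ∧ ∃ U : Set X, IsOpen U ∧ A ⊆ U ∧
    ∃ e : U → EuclideanSpace ℝ (Fin n), Topology.IsEmbedding e ∧ IsOpen (Set.range e) ∧
      IsStarlike (e '' {x : U | (x : X) ∈ A})

/-- The image `A/B` of `A` in the quotient `X/B` of `X` obtained by identifying the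
compact set `B ⊆ A` to a point is a squeezable subset of `X/B`, for some
(equivalently, by metric-independence, any) metric inducing the quotient topology.
The quotient `X/B` is modelled by an arbitrary compact metric space `Y` together with a
continuous surjection `π : X → Y` whose fibers are `B` and the singletons of `X − B`
(such a map from the compact space `X` to the metrizable space `Y` is automatically a
closed quotient map, so `Y` is `X/B` with a metric inducing the quotient topology). -/
def SqueezableInQuotient {X : Type u} [MetricSpace X] (B A : Set X) : Prop :=
  ∃ (Y : Type u) (mY : MetricSpace Y) (π : X → Y),
    letI := mY
    Continuous π ∧ Function.Surjective π ∧
      (∀ x y : X, π x = π y ↔ x = y ∨ (x ∈ B ∧ y ∈ B)) ∧ Squeezable (π '' A)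

/-- `A/B` is a squashable subset of `X/B`; see `SqueezableInQuotient`. -/
def SquashableInQuotient {X : Type u} [MetricSpace X] (B A : Set X) : Prop :=
  ∃ (Y : Type u) (mY : MetricSpace Y) (π : X → Y),
    letI := mY
    Continuous π ∧ Function.Surjective π ∧
      (∀ x y : X, π x = π y ↔ x = y ∨ (x ∈ B ∧ y ∈ B)) ∧ Squashable (π '' A)

/-- `A/B` is a starlike-equivalent subset of `X/B`; see `SqueezableInQuotient`. -/
def StarlikeEquivalentInQuotient {X : Type u} [MetricSpace X] (B A : Set X) : Prop :=
  ∃ (Y : Type u) (mY : MetricSpace Y) (π : X → Y),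
    letI := mY
    Continuous π ∧ Function.Surjective π ∧
      (∀ x y : X, π x = π y ↔ x = y ∨ (x ∈ B ∧ y ∈ B)) ∧ IsStarlikeEquivalent (π '' A)

/-- `A` is recursively squeezable of filtration length `≤ n`: there is a chain
`A₁ ⊆ ⋯ ⊆ A_{n+1} = A` of compact subsets of `X` with `A₁` squeezable in `X` and
`A_{i+1}/A_i` squeezable in `X/A_i` for each `i`. -/
def RecursivelySqueezableOfLength {X : Type u} [MetricSpace X] (n : ℕ) (A : Set X) :
    Prop :=
  ∃ F : Fin (n + 1) → Set X,
    (∀ i, IsCompact (F i)) ∧ Monotone F ∧ F (Fin.last n) = A ∧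
    Squeezable (F 0) ∧ ∀ i : Fin n, SqueezableInQuotient (F i.castSucc) (F i.succ)

/-- `A` is recursively squeezable: recursively squeezable of filtration length `≤ n`
for some `n ≥ 0`. -/
def RecursivelySqueezable {X : Type u} [MetricSpace X] (A : Set X) : Prop :=
  ∃ n : ℕ, RecursivelySqueezableOfLength n A

/-- `A` is recursively squashable of filtration length `≤ n`. -/
def RecursivelySquashableOfLength {X : Type u} [MetricSpace X] (n : ℕ) (A : Set X) :
    Prop :=
  ∃ F : Fin (n + 1) → Set X,
    (∀ i, IsCompact (F i)) ∧ Monotone F ∧ F (Fin.last n) = A ∧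
    Squashable (F 0) ∧ ∀ i : Fin n, SquashableInQuotient (F i.castSucc) (F i.succ)

/-- `A` is recursively squashable. -/
def RecursivelySquashable {X : Type u} [MetricSpace X] (A : Set X) : Prop :=
  ∃ n : ℕ, RecursivelySquashableOfLength n A

/-- `A` is recursively starlike-equivalent of filtration length `≤ n`. -/
def RecursivelyStarlikeEquivalentOfLength {X : Type u} [MetricSpace X] (n : ℕ)
    (A : Set X) : Prop :=
  ∃ F : Fin (n + 1) → Set X,
    (∀ i, IsCompact (F i)) ∧ Monotone F ∧ F (Fin.last n) = A ∧
    IsStarlikeEquivalent (F 0) ∧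
    ∀ i : Fin n, StarlikeEquivalentInQuotient (F i.castSucc) (F i.succ)

/-- `A` is recursively starlike-equivalent. -/
def RecursivelyStarlikeEquivalent {X : Type u} [MetricSpace X] (A : Set X) : Prop :=
  ∃ n : ℕ, RecursivelyStarlikeEquivalentOfLength n A

section Decompositions

variable {X : Type u} [MetricSpace X]

/-- In a compact metric space, a null partition into nonempty compact sets is automatically
upper semi-continuous. -/
theorem IsNullCollection.isUSCDecomposition {𝒢 : Set (Set X)} (hnull : IsNullCollection 𝒢)
    (hc : ∀ G ∈ 𝒢, IsCompact G ∧ G.Nonempty) (hp : ∀ x : X, ∃! G, G ∈ 𝒢 ∧ x ∈ G) :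
    IsUSCDecomposition 𝒢 := by
  refine ⟨hc, hp, fun K hK => ?_⟩
  have hequiv : Equivalence (fun x y : X => ∃ G ∈ 𝒢, x ∈ G ∧ y ∈ G) := by
    refine ⟨fun x => ?_, ?_, ?_⟩
    · obtain ⟨G, ⟨hG, hx⟩, -⟩ := hp x
      exact ⟨G, hG, hx, hx⟩
    · rintro x y ⟨G, hG, hx, hy⟩
      exact ⟨G, hG, hy, hx⟩
    · rintro x y z ⟨G, hG, hx, hy⟩ ⟨H, hH, hy', hz⟩
      have : G = H := (hp y).unique ⟨hG, hy⟩ ⟨hH, hy'⟩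
      exact ⟨G, hG, hx, this ▸ hz⟩
  have hquot : Topology.IsQuotientMap
      (Quot.mk (fun x y : X => ∃ G ∈ 𝒢, x ∈ G ∧ y ∈ G)) := isQuotientMap_quot_mk
  rw [← hquot.isClosed_preimage]
  have hsat : Quot.mk (fun x y : X => ∃ G ∈ 𝒢, x ∈ G ∧ y ∈ G) ⁻¹'
      (Quot.mk (fun x y : X => ∃ G ∈ 𝒢, x ∈ G ∧ y ∈ G) '' K) =
      {x | ∃ k ∈ K, ∃ G ∈ 𝒢, k ∈ G ∧ x ∈ G} := by
    ext x
    constructor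
    · rintro ⟨k, hk, h⟩
      exact ⟨k, hk, hequiv.eqvGen_iff.1 (Quot.eqvGen_exact h)⟩
    · rintro ⟨k, hk, h⟩
      exact ⟨k, hk, Quot.sound h⟩
  rw [hsat]
  refine isClosed_of_closure_subset fun x hx => ?_
  by_cases hxK : x ∈ K
  · obtain ⟨G, ⟨hG, hxG⟩, -⟩ := hp x
    exact ⟨x, hxK, G, hG, hxG, hxG⟩
  obtain ⟨ε, hε, hεK⟩ : ∃ ε > 0, x ∉ cthickening ε K := by
    have : x ∉ ⋂ ε > 0, cthickening ε K := by
      rwa [← closure_eq_iInter_cthickening, hK.closure_eq]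
    simpa using this
  set big : Set (Set X) := {G | G ∈ {C | C ∈ 𝒢 ∧ ε ≤ diam C} ∧ (G ∩ K).Nonempty}
  have hfin : big.Finite := (hnull ε hε).subset fun G hG => hG.1
  have hcl : IsClosed (cthickening ε K ∪ ⋃ G ∈ big, G) :=
    isClosed_cthickening.union (hfin.isClosed_biUnion fun G hG => (hc G hG.1.1).1.isClosed)
  have hsub : {x | ∃ k ∈ K, ∃ G ∈ 𝒢, k ∈ G ∧ x ∈ G} ⊆ cthickening ε K ∪ ⋃ G ∈ big, G := by
    rintro z ⟨k, hk, G, hG, hkG, hzG⟩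
    by_cases hd : ε ≤ diam G
    · exact Or.inr (mem_iUnion₂.2 ⟨G, ⟨⟨hG, hd⟩, k, hkG, hk⟩, hzG⟩)
    · refine Or.inl (mem_cthickening_of_dist_le z k ε K hk ?_)
      exact (dist_le_diam_of_mem (hc G hG).1.isBounded hzG hkG).trans (not_le.1 hd).le
  rcases closure_minimal hsub hcl hx with h | h
  · exact absurd h hεK
  · obtain ⟨G, ⟨⟨hG, -⟩, k, hkG, hk⟩, hxG⟩ := mem_iUnion₂.1 h
    exact ⟨k, hk, G, hG, hkG, hxG⟩

variable [CompactSpace X]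

theorem isUSCDecomposition_range_fiber {Y : Type v} [MetricSpace Y] {π : X → Y}
    (hπ : Continuous π) (hsurj : Surjective π)
    (hnull : IsNullCollection (range fun y => π ⁻¹' {y})) :
    IsUSCDecomposition (range fun y => π ⁻¹' {y}) := by
  refine hnull.isUSCDecomposition ?_ fun x => ⟨π ⁻¹' {π x}, ⟨⟨π x, rfl⟩, rfl⟩, ?_⟩
  · rintro _ ⟨y, rfl⟩
    exact ⟨(isClosed_singleton.preimage hπ).isCompact, hsurj y⟩
  · rintro _ ⟨⟨y, rfl⟩, hx⟩
    rw [mem_preimage, mem_singleton_iff] at hx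
    rw [hx]

/-- Only finitely many members of a null collection have large image under a given continuous
map on a compact space. -/
theorem IsNullCollection.finite_le_diam_image {Y : Type v} [MetricSpace Y]
    {𝒢 : Set (Set X)} (hnull : IsNullCollection 𝒢) {f : X → Y} (hf : Continuous f)
    {ε : ℝ} (hε : 0 < ε) : {G | G ∈ 𝒢 ∧ ε ≤ diam (f '' G)}.Finite := by
  obtain ⟨η, hη, h⟩ := Metric.uniformContinuous_iff.1
    (CompactSpace.uniformContinuous_of_continuous hf) (ε / 2) (half_pos hε)
  refine (hnull η hη).subset fun G hG => ⟨hG.1, ?_⟩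
  by_contra! hlt
  have : diam (f '' G) ≤ ε / 2 := by
    refine diam_le_of_forall_dist_le (half_pos hε).le ?_
    rintro _ ⟨x, hx, rfl⟩ _ ⟨y, hy, rfl⟩
    exact (h ((dist_le_diam_of_mem (isBounded_of_compactSpace) hx hy).trans_lt hlt)).le
  linarith [hG.2]

theorem diam_image_le_of_dist_le {Y : Type*} [MetricSpace Y] [CompactSpace Y] {Z : Type*}
    {f g : Z → Y} {ε : ℝ} (hε : 0 ≤ ε) (h : ∀ x, dist (f x) (g x) ≤ ε) (S : Set Z) :
    diam (f '' S) ≤ diam (g '' S) + 2 * ε := by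
  refine diam_le_of_forall_dist_le (by positivity) ?_
  rintro _ ⟨x, hx, rfl⟩ _ ⟨y, hy, rfl⟩
  have h1 := dist_triangle4 (f x) (g x) (g y) (f y)
  have h2 := dist_le_diam_of_mem (isBounded_of_compactSpace (s := g '' S))
    (mem_image_of_mem g hx) (mem_image_of_mem g hy)
  have h3 := h x
  have h4 := h y
  rw [dist_comm (f y)] at h4
  linarith

end Decompositions

section Shrinking

theorem Homeomorph.apply_mem_of_support {X : Type*} [TopologicalSpace X] (h : X ≃ₜ X)
    {U : Set X} (hU : ∀ x ∉ U, h x = x) {x : X} (hx : x ∈ U) : h x ∈ U := by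
  by_contra hn
  have := h.injective (hU _ hn)
  rw [this] at hn
  exact hn hx

/-- Finitely many homeomorphisms with disjoint supports can be combined. -/
theorem exists_homeomorph_of_disjoint_supports {X ι : Type*} [TopologicalSpace X]
    (T : Finset ι) (U : ι → Set X) (h : ι → X ≃ₜ X)
    (hdisj : (T : Set ι).PairwiseDisjoint U) (hsupp : ∀ i ∈ T, ∀ x ∉ U i, h i x = x) :
    ∃ H : X ≃ₜ X, (∀ i ∈ T, ∀ x ∈ U i, H x = h i x) ∧ ∀ x, (∀ i ∈ T, x ∉ U i) → H x = x := by
  classical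
  induction T using Finset.induction_on with
  | empty => exact ⟨Homeomorph.refl X, by simp, by simp⟩
  | insert j T hj ih =>
    obtain ⟨H, hH, hH'⟩ := ih (hdisj.subset (by simp))
      fun i hi => hsupp i (Finset.mem_insert_of_mem hi)
    have hne : ∀ i ∈ T, ∀ x ∈ U j, x ∉ U i := fun i hi x hxj hxi =>
      disjoint_left.1 (hdisj (by simp) (by simp [hi]) (ne_of_mem_of_not_mem hi hj).symm) hxj hxi
    have hsj := hsupp j (Finset.mem_insert_self j T)
    refine ⟨(h j).trans H, fun i hi x hx => ?_, fun x hx => ?_⟩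
    · rcases Finset.mem_insert.1 hi with rfl | hi
      · exact hH' _ fun k hk => hne k hk _ ((h i).apply_mem_of_support hsj hx)
      · have hxj : x ∉ U j := fun hxj => hne i hi x hxj hx
        simp [hsj x hxj, hH i hi x hx]
    · have hxj := hx j (Finset.mem_insert_self j T)
      simp [hsj x hxj, hH' x fun i hi => hx i (Finset.mem_insert_of_mem hi)]

/-- A map from a compact metric space whose fibers form a null collection with squeezable
nondegenerate members satisfies the strong shrinking criterion. -/
theorem satisfiesStrongShrinkingCriterion_of_squeezable {X : Type u} {Y : Type v}
    [MetricSpace X] [CompactSpace X] [MetricSpace Y] {π : X → Y}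
    (hπ : Continuous π) (hsurj : Surjective π)
    (hnull : IsNullCollection (range fun y => π ⁻¹' {y}))
    (hsq : ∀ y, ¬ (π ⁻¹' {y}).Subsingleton → Squeezable (π ⁻¹' {y})) :
    SatisfiesStrongShrinkingCriterion π := by
  intro δ hδ C hC hinj
  have husc := isUSCDecomposition_range_fiber hπ hsurj hnull
  have hSfin : {y | δ ≤ diam (π ⁻¹' {y})}.Finite := by
    refine ((hnull δ hδ).preimage (f := fun y => π ⁻¹' {y}) ?_).subset
      fun y hy => ⟨⟨y, rfl⟩, hy⟩
    exact (preimage_injective.2 hsurj).comp singleton_injective |>.injOn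
  obtain ⟨S, hS⟩ : ∃ S : Finset Y, ∀ y, y ∈ S ↔ δ ≤ diam (π ⁻¹' {y}) :=
    ⟨hSfin.toFinset, by simp⟩
  have hns : ∀ y ∈ S, ¬ (π ⁻¹' {y}).Subsingleton := fun y hy hsub => by
    have := (hS y).1 hy
    rw [diam_subsingleton hsub] at this
    linarith
  have hSC : ∀ y ∈ S, y ∉ C := fun y hy hyC => hns y hy fun x hx x' hx' => by
    rw [mem_preimage, mem_singleton_iff] at hx hx'
    exact hinj (by simpa [hx]) (by simpa [hx']) (hx.trans hx'.symm)
  have hSd : ∀ y ∈ S, ∃ r > 0, ∀ z, (z ∈ C ∨ z ∈ S ∧ z ≠ y) → r ≤ dist z y := by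
    intro y hy
    have hcl : IsClosed (C ∪ ((S : Set Y) \ {y})) :=
      hC.union (S.finite_toSet.subset sdiff_subset).isClosed
    have hy' : y ∈ (C ∪ ((S : Set Y) \ {y}))ᶜ := by simp [hSC y hy]
    obtain ⟨r, hr, h⟩ := Metric.isOpen_iff.1 hcl.isOpen_compl y hy'
    refine ⟨r, hr, fun z hz => ?_⟩
    by_contra! hlt
    exact h hlt (by simpa using hz)
  choose! ρ hρ hρd using hSd
  obtain ⟨r, hr, hrδ, hrρ⟩ : ∃ r > 0, 2 * r ≤ δ ∧ ∀ y ∈ S, 2 * r ≤ ρ y := by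
    have hev : ∀ᶠ r in nhdsWithin (0 : ℝ) (Ioi 0), ∀ a ∈ insert δ (S.image ρ : Set ℝ), 2 * r ≤ a := by
      have hf : (insert δ (S.image ρ : Set ℝ)).Finite := (Finset.finite_toSet _).insert _
      rw [Filter.eventually_all_finite hf]
      intro a ha
      have ha0 : 0 < a := by
        rcases ha with rfl | ha
        · exact hδ
        · obtain ⟨y, hy, rfl⟩ := by simpa using ha
          exact hρ y hy
      filter_upwards [Ioo_mem_nhdsGT (half_pos ha0)] with r hr
      linarith [hr.2]
    obtain ⟨r, hr, hr0⟩ := (hev.and self_mem_nhdsWithin).exists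
    exact ⟨r, hr0, hr δ (by simp), fun y hy => hr _ (Or.inr (by simpa using ⟨y, hy, rfl⟩))⟩
  have hex : ∀ y ∈ S, ∃ h : X ≃ₜ X, (∀ x ∉ π ⁻¹' ball y r, h x = x) ∧
      diam (h '' (π ⁻¹' {y})) < δ ∧
      ∀ G ∈ range fun y => π ⁻¹' {y}, diam (h '' G) < δ ∨ ∀ x ∈ G, h x = x := fun y hy =>
    (hsq y (hns y hy)).2 _ husc hnull ⟨y, rfl⟩ _ (isOpen_ball.preimage hπ)
      (preimage_mono (by simpa using hr)) δ hδ
  choose! h hsupp hdiam hsmall using hex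
  have hdisj : (S : Set Y).PairwiseDisjoint fun y => π ⁻¹' ball y r := by
    intro y hy z hz hyz
    refine Disjoint.preimage π (ball_disjoint_ball ?_)
    have h1 := hρd z hz y (Or.inr ⟨hy, hyz⟩)
    linarith [hrρ z hz]
  obtain ⟨H, hH, hH'⟩ := exists_homeomorph_of_disjoint_supports S _ h hdisj hsupp
  refine ⟨H, fun z => ?_, fun x => ?_, fun x hx => ?_⟩
  · by_cases hz : ∃ y ∈ S, z ∈ ball y r
    · obtain ⟨y, hy, hzy⟩ := hz
      have himg : H '' (π ⁻¹' {z}) = h y '' (π ⁻¹' {z}) := by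
        refine image_congr fun x hx => hH y hy x ?_
        rw [mem_preimage, mem_singleton_iff] at hx
        rwa [mem_preimage, hx]
      rw [himg]
      rcases eq_or_ne z y with rfl | hne
      · exact hdiam z hy
      · rcases hsmall y hy _ ⟨z, rfl⟩ with hlt | hid
        · exact hlt
        · rw [image_congr hid, image_id']
          by_contra! hle
          have h1 := hρd y hy z (Or.inr ⟨(hS z).2 hle, hne⟩)
          rw [mem_ball] at hzy
          linarith [hrρ y hy]
    · push Not at hz
      have himg : H '' (π ⁻¹' {z}) = π ⁻¹' {z} := by
        conv_rhs => rw [← image_id' (π ⁻¹' {z})]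
        refine image_congr fun x hx => hH' x fun y hy => ?_
        rw [mem_preimage, mem_singleton_iff] at hx
        rw [mem_preimage, hx]
        exact hz y hy
      rw [himg]
      by_contra! hle
      exact hz z ((hS z).2 hle) (mem_ball_self hr)
  · obtain ⟨w, rfl⟩ := H.surjective x
    rw [H.symm_apply_apply]
    by_cases hw : ∃ y ∈ S, w ∈ π ⁻¹' ball y r
    · obtain ⟨y, hy, hwy⟩ := hw
      rw [hH y hy w hwy]
      have h1 : π (h y w) ∈ ball y r := (h y).apply_mem_of_support (hsupp y hy) hwy
      have h2 : π w ∈ ball y r := hwy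
      have := dist_triangle_right (π (h y w)) (π w) y
      rw [mem_ball] at h1 h2
      linarith
    · push Not at hw
      rw [hH' w hw, dist_self]
      exact hδ
  · refine hH' x fun y hy hxy => ?_
    have h1 := hρd y hy (π x) (Or.inl hx)
    have h2 : dist (π x) y < r := hxy
    linarith [hrρ y hy]

/-- Bing's shrinking theorem, relative to a closed set over which the map injects. -/
theorem SatisfiesStrongShrinkingCriterion.isStrongNearHomeomorphism {X : Type u} {Y : Type v}
    [MetricSpace X] [CompactSpace X] [MetricSpace Y] [CompactSpace Y] {π : X → Y}
    (hπ : Continuous π) (hsurj : Surjective π) (hs : SatisfiesStrongShrinkingCriterion π) :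
    IsStrongNearHomeomorphism π := by
  intro ε hε C hC hinj
  set P : Set (X ≃ₜ X) := {k | ∀ x ∈ π ⁻¹' C, k x = x}
  let F : (X ≃ₜ X) → C(X, Y) := fun k => ⟨fun x => π (k x), hπ.comp k.continuous⟩
  set E : Set C(X, Y) := closure (F '' P)
  have : CompleteSpace E := isClosed_closure.completeSpace_coe
  let D : ℕ → Set C(X, Y) := fun n =>
    {f | ∀ x x', f x = f x' → dist x x' < 1 / ((n : ℝ) + 1)}
  have hDopen : ∀ n, IsOpen (D n) := by
    intro n
    have hcl : IsClosed {p : (X × X) × C(X, Y) |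
        1 / ((n : ℝ) + 1) ≤ dist p.1.1 p.1.2 ∧ p.2 p.1.1 = p.2 p.1.2} := by
      refine IsClosed.and (isClosed_le continuous_const (by fun_prop)) (isClosed_eq ?_ ?_)
      · exact continuous_snd.eval (continuous_fst.comp continuous_fst)
      · exact continuous_snd.eval (continuous_snd.comp continuous_fst)
    have := isClosedMap_snd_of_compactSpace _ hcl
    rw [← isOpen_compl_iff] at this
    convert this using 1
    ext f
    simp only [D, mem_ofPred_eq, mem_compl_iff, mem_image, Prod.exists, not_exists, not_and]
    constructor
    · rintro h x x' g ⟨hd, he⟩ rfl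
      exact absurd (h x x' he) (not_lt.2 hd)
    · intro h x x' he
      by_contra! hd
      exact h x x' f ⟨hd, he⟩ rfl
  have hDdense : ∀ n, Dense ((↑) ⁻¹' D n : Set E) := by
    intro n
    refine Metric.dense_iff.2 ?_
    rintro ⟨f, hf⟩ η hη
    obtain ⟨_, ⟨k, hk, rfl⟩, hfk⟩ := Metric.mem_closure_iff.1 hf (η / 2) (half_pos hη)
    obtain ⟨ξ, hξ, hkξ⟩ := Metric.uniformContinuous_iff.1
      (CompactSpace.uniformContinuous_of_continuous k.symm.continuous) (1 / ((n : ℝ) + 1))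
      (by positivity)
    obtain ⟨h, hdiam, hclose, hfix⟩ := hs (min ξ (η / 2)) (lt_min hξ (half_pos hη)) C hC hinj
    have hmem : k.trans h.symm ∈ P := fun x hx => by
      rw [Homeomorph.trans_apply, hk x hx, Homeomorph.symm_apply_eq, hfix x hx]
    refine ⟨⟨F (k.trans h.symm), subset_closure ⟨_, hmem, rfl⟩⟩, ?_, ?_⟩
    · rw [mem_ball, Subtype.dist_eq, dist_comm]
      have h2 : dist (F k) (F (k.trans h.symm)) < η / 2 := by
        refine (ContinuousMap.dist_lt_iff (half_pos hη)).2 fun x => ?_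
        exact (hclose (k x)).trans_le (min_le_right _ _)
      linarith [dist_triangle f (F k) (F (k.trans h.symm))]
    · intro x x' hxx'
      have hxx : π (h.symm (k x)) = π (h.symm (k x')) := hxx'
      have hd : dist (k x) (k x') < ξ := by
        refine lt_of_le_of_lt ?_ ((hdiam (π (h.symm (k x)))).trans_le (min_le_left _ _))
        exact dist_le_diam_of_mem isBounded_of_compactSpace
          ⟨h.symm (k x), rfl, h.apply_symm_apply _⟩ ⟨h.symm (k x'), hxx.symm, h.apply_symm_apply _⟩
      simpa using hkξ hd
  have hbase : F (Homeomorph.refl X) ∈ E := subset_closure ⟨_, fun x _ => rfl, rfl⟩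
  obtain ⟨⟨f, hfE⟩, hfD, hfball⟩ := (dense_iInter_of_isOpen_nat
    (fun n => (hDopen n).preimage continuous_subtype_val) hDdense).exists_dist_lt
      ⟨_, hbase⟩ hε
  rw [Subtype.dist_eq] at hfball
  have hfinj : Injective f := by
    intro x x' hxx'
    by_contra hne
    obtain ⟨n, hn⟩ := exists_nat_one_div_lt (dist_pos.2 hne)
    exact (hn.trans (mem_iInter.1 hfD n x x' hxx')).false
  have hfsurj : Surjective f := by
    intro y
    have : y ∈ closure (range f) := by
      refine Metric.mem_closure_iff.2 fun η hη => ?_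
      obtain ⟨_, ⟨k, -, rfl⟩, hfk⟩ := Metric.mem_closure_iff.1 hfE η hη
      obtain ⟨x, hx⟩ := (hsurj.comp k.surjective) y
      refine ⟨f x, ⟨x, rfl⟩, ?_⟩
      rw [dist_comm, ← hx]
      exact (ContinuousMap.dist_apply_le_dist x).trans_lt hfk
    rwa [(isCompact_range f.continuous).isClosed.closure_eq] at this
  refine ⟨Continuous.homeoOfEquivCompactToT2 (f := Equiv.ofBijective f ⟨hfinj, hfsurj⟩)
    f.continuous, fun x => ?_, fun x hx => ?_⟩
  · exact (ContinuousMap.dist_apply_le_dist (f := F (Homeomorph.refl X)) x).trans_lt hfball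
  · have hcl : IsClosed {g : C(X, Y) | g x = π x} :=
      isClosed_eq (continuous_eval_const x) continuous_const
    refine closure_minimal ?_ hcl hfE
    rintro _ ⟨k, hk, rfl⟩
    exact congrArg π (hk x hx)

end Shrinking

section Recursive

/-- If `B ⊆ A` is squeezable and `A/B` is squeezable in `X/B`, then `A` is squeezable. -/
theorem Squeezable.of_quotient {X : Type u} [MetricSpace X] [CompactSpace X] {A B : Set X}
    (hA : IsCompact A) (hBA : B ⊆ A) (hB : Squeezable B) (hq : SqueezableInQuotient B A) :
    Squeezable A := by
  obtain ⟨Y, mY, q, hqc, hqs, hqf, -, hqA⟩ := hq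
  have : CompactSpace Y := hqs.compactSpace hqc
  refine ⟨hA, fun 𝒢 ⟨hcpt, hpart, _⟩ hnull hAG U hU hAU δ₀ hδ₀ => ?_⟩
  obtain ⟨δ, hδ, hδδ₀⟩ : ∃ δ > 0, 9 * δ ≤ δ₀ := ⟨δ₀ / 9, by positivity, by linarith⟩
  have hdisj : ∀ G ∈ 𝒢, G ≠ A → Disjoint G A := fun G hG hne =>
    disjoint_left.2 fun x hx hxA => hne ((hpart x).unique ⟨hG, hx⟩ ⟨hAG, hxA⟩)
  -- open neighbourhoods of `B` missing any given finite part of the decomposition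
  have hnhd : ∀ W : Set X, IsOpen W → B ⊆ W → ∀ 𝒞 : Set (Set X), 𝒞.Finite →
      (∀ G ∈ 𝒞, G ∈ 𝒢) →
      ∃ V : Set X, IsOpen V ∧ B ⊆ V ∧ V ⊆ W ∧ V ⊆ U ∧
        ∀ G ∈ 𝒞, G ≠ A → ∀ x ∈ G, x ∉ V := by
    intro W hW hBW 𝒞 hfin h𝒞
    have hcl : IsClosed (⋃ G ∈ 𝒞 \ {A}, G) :=
      (hfin.subset sdiff_subset).isClosed_biUnion fun G hG => (hcpt G (h𝒞 G hG.1)).1.isClosed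
    refine ⟨W ∩ U ∩ (⋃ G ∈ 𝒞 \ {A}, G)ᶜ, (hW.inter hU).inter hcl.isOpen_compl,
      fun x hx => ⟨⟨hBW hx, hAU (hBA hx)⟩, fun hmem => ?_⟩, fun x hx => hx.1.1,
      fun x hx => hx.1.2, fun G hG hne x hx hmem => hmem.2 (mem_biUnion ⟨hG, hne⟩ hx)⟩
    obtain ⟨G, hG, hxG⟩ := mem_iUnion₂.1 hmem
    exact disjoint_left.1 (hdisj G (h𝒞 G hG.1) hG.2) hxG (hBA hx)
  -- the quotient map is a strong near homeomorphism
  have hnear : IsStrongNearHomeomorphism q := by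
    have hfib : ∀ y, ¬ (q ⁻¹' {y}).Subsingleton → q ⁻¹' {y} = B := by
      intro y hy
      obtain ⟨x, hx, x', hx', hne⟩ := not_subsingleton_iff.1 hy
      rw [mem_preimage, mem_singleton_iff] at hx hx'
      have hxB := ((hqf x x').1 (hx.trans hx'.symm)).resolve_left hne
      ext z
      rw [mem_preimage, mem_singleton_iff, ← hx, hqf]
      constructor
      · rintro (rfl | h)
        exacts [hxB.1, h.1]
      · exact fun h => Or.inr ⟨h, hxB.1⟩
    refine (satisfiesStrongShrinkingCriterion_of_squeezable hqc hqs ?_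
      fun y hy => by rwa [hfib y hy]).isStrongNearHomeomorphism hqc hqs
    refine fun ε hε => (finite_singleton B).subset ?_
    rintro _ ⟨⟨y, rfl⟩, hy⟩
    refine hfib y fun hsub => ?_
    rw [diam_subsingleton hsub] at hy
    linarith
  have happrox : ∀ V : Set X, IsOpen V → B ⊆ V → ∀ ε > 0,
      ∃ φ : X ≃ₜ Y, (∀ x, dist (q x) (φ x) < ε) ∧ ∀ x ∉ V, φ x = q x := by
    intro V hV hBV ε hε
    have hinj : InjectsOver q (q '' Vᶜ) := by
      rintro x ⟨z, hz, hzx⟩ x' - hxx'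
      rcases (hqf x x').1 hxx' with h | ⟨hx, -⟩
      · exact h
      · rcases (hqf z x).1 hzx with rfl | h
        exacts [absurd (hBV hx) hz, absurd (hBV h.1) hz]
    obtain ⟨φ, hφ, hφC⟩ := hnear ε hε _ (hV.isClosed_compl.isCompact.image hqc).isClosed hinj
    exact ⟨φ, hφ, fun x hx => hφC x ⟨x, hx, rfl⟩⟩
  -- squeeze `B` while controlling the other elements
  obtain ⟨h₀, h₀U, h₀B, h₀G⟩ : ∃ h : X ≃ₜ X, (∀ x ∉ U, h x = x) ∧ diam (h '' B) < δ ∧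
      ∀ G ∈ 𝒢, G ≠ A → diam (h '' G) < δ ∨ ∀ x ∈ G, h x = x := by
    rcases B.eq_empty_or_nonempty with rfl | hBne
    · exact ⟨Homeomorph.refl X, fun _ _ => rfl, by simpa using hδ,
        fun _ _ _ => Or.inr fun _ _ => rfl⟩
    set 𝒢' : Set (Set X) := (𝒢 \ {A}) ∪ {B} ∪ ((fun x => {x}) '' (A \ B))
    have hnull' : IsNullCollection 𝒢' := by
      refine fun ε hε => ((hnull ε hε).union (finite_singleton B)).subset ?_
      rintro G ⟨(hG | hG) | ⟨x, -, rfl⟩, hd⟩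
      · exact Or.inl ⟨hG.1, hd⟩
      · exact Or.inr hG
      · rw [diam_singleton] at hd
        linarith
    have husc' : IsUSCDecomposition 𝒢' := by
      refine hnull'.isUSCDecomposition ?_ fun x => ?_
      · rintro G ((hG | rfl) | ⟨x, -, rfl⟩)
        exacts [hcpt G hG.1, ⟨hB.1, hBne⟩, ⟨isCompact_singleton, singleton_nonempty x⟩]
      · by_cases hxA : x ∈ A
        · have hno : ∀ G ∈ 𝒢 \ {A}, x ∉ G := fun G hG hx =>
            disjoint_left.1 (hdisj G hG.1 hG.2) hx hxA
          by_cases hxB : x ∈ B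
          · refine ⟨B, ⟨Or.inl (Or.inr rfl), hxB⟩, ?_⟩
            rintro G ⟨(hG | rfl) | ⟨z, hz, rfl⟩, hx⟩
            · exact absurd hx (hno G hG)
            · rfl
            · rw [mem_singleton_iff] at hx
              exact absurd (hx ▸ hxB) hz.2
          · refine ⟨{x}, ⟨Or.inr ⟨x, ⟨hxA, hxB⟩, rfl⟩, rfl⟩, ?_⟩
            rintro G ⟨(hG | rfl) | ⟨z, hz, rfl⟩, hx⟩
            · exact absurd hx (hno G hG)
            · exact absurd hx hxB
            · rw [mem_singleton_iff] at hx
              rw [hx]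
        · obtain ⟨G, ⟨hG, hxG⟩, huniq⟩ := hpart x
          refine ⟨G, ⟨Or.inl (Or.inl ⟨hG, fun e => hxA (e ▸ hxG)⟩), hxG⟩, ?_⟩
          rintro G' ⟨(hG' | rfl) | ⟨z, hz, rfl⟩, hx⟩
          · exact huniq G' ⟨hG'.1, hx⟩
          · exact absurd (hBA hx) hxA
          · rw [mem_singleton_iff] at hx
            exact absurd (hx ▸ hz.1) hxA
    obtain ⟨h, hU', hdB, hG⟩ := hB.2 𝒢' husc' hnull' (Or.inl (Or.inr rfl)) U hU
      (hBA.trans hAU) δ hδ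
    exact ⟨h, hU', hdB, fun G hG' hne => hG G (Or.inl (Or.inl ⟨hG', hne⟩))⟩
  -- replace `h₀` by a map `f` which collapses `B` to a point
  obtain ⟨V₁, hV₁, hBV₁, hV₁W, hV₁U, hV₁G⟩ := hnhd (h₀ ⁻¹' thickening δ (h₀ '' B))
    (isOpen_thickening.preimage h₀.continuous)
    (fun x hx => self_subset_thickening hδ _ (mem_image_of_mem h₀ hx)) _
    (hnull.finite_le_diam_image h₀.continuous hδ) fun G hG => hG.1
  obtain ⟨φ, -, hφ⟩ := happrox V₁ hV₁ hBV₁ 1 one_pos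
  let p : Y ≃ₜ X := φ.symm.trans h₀
  have hφsymm : ∀ x ∉ V₁, φ.symm (q x) = x := fun x hx => by
    rw [Homeomorph.symm_apply_eq, hφ x hx]
  have hpV₁ : ∀ x ∉ V₁, p (q x) = h₀ x := fun x hx => by
    simp [p, hφsymm x hx]
  have hpdist : ∀ x, dist (p (q x)) (h₀ x) ≤ 3 * δ := by
    intro x
    by_cases hx : x ∈ V₁
    · have hx' : φ.symm (q x) ∈ V₁ := by
        by_contra hn
        have h1 := hφ _ hn
        rw [φ.apply_symm_apply, hqf] at h1
        rcases h1 with h1 | h1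
        · exact hn (h1 ▸ hx)
        · exact hn (hBV₁ h1.2)
      obtain ⟨b, hb, hbd⟩ := mem_thickening_iff.1 (hV₁W hx)
      obtain ⟨b', hb', hbd'⟩ := mem_thickening_iff.1 (hV₁W hx')
      have h1 := dist_triangle4 (p (q x)) b' b (h₀ x)
      have h2 := dist_le_diam_of_mem isBounded_of_compactSpace hb' hb
      have h3 : dist (p (q x)) b' < δ := hbd'
      rw [dist_comm] at hbd
      linarith
    · rw [hpV₁ x hx, dist_self]
      positivity
  have hpG : ∀ G ∈ 𝒢, G ≠ A →
      diam ((fun x => p (q x)) '' G) < 7 * δ ∨ ∀ x ∈ G, p (q x) = x := by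
    intro G hG hne
    by_cases hd : diam (h₀ '' G) < δ
    · left
      have := diam_image_le_of_dist_le (by positivity) hpdist G
      linarith
    · right
      intro x hx
      rw [hpV₁ x (hV₁G G ⟨hG, not_lt.1 hd⟩ hne x hx)]
      exact (h₀G G hG hne).resolve_left hd x hx
  -- squeeze the image of `A` in the quotient
  set 𝒬 : Set (Set Y) := (fun G => q '' G) '' 𝒢
  have hnullQ : IsNullCollection 𝒬 := by
    refine fun ε hε => ((hnull.finite_le_diam_image hqc hε).image fun G => q '' G).subset ?_
    rintro _ ⟨⟨G, hG, rfl⟩, hd⟩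
    exact ⟨G, ⟨hG, hd⟩, rfl⟩
  have huscQ : IsUSCDecomposition 𝒬 := by
    refine hnullQ.isUSCDecomposition ?_ fun y => ?_
    · rintro _ ⟨G, hG, rfl⟩
      exact ⟨(hcpt G hG).1.image hqc, (hcpt G hG).2.image q⟩
    · obtain ⟨x, rfl⟩ := hqs y
      obtain ⟨G, ⟨hG, hxG⟩, huniq⟩ := hpart x
      refine ⟨q '' G, ⟨⟨G, hG, rfl⟩, mem_image_of_mem q hxG⟩, ?_⟩
      rintro _ ⟨⟨G', hG', rfl⟩, z, hz, hzx⟩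
      rcases (hqf z x).1 hzx with rfl | ⟨hzB, hxB⟩
      · rw [huniq G' ⟨hG', hz⟩]
      · rw [(hpart z).unique ⟨hG', hz⟩ ⟨hAG, hBA hzB⟩,
          (hpart x).unique ⟨hG, hxG⟩ ⟨hAG, hBA hxB⟩]
  obtain ⟨η, hη, hpη⟩ := Metric.uniformContinuous_iff.1
    (CompactSpace.uniformContinuous_of_continuous p.continuous) δ hδ
  obtain ⟨g, hgU, hgA, hgG⟩ := hqA 𝒬 huscQ hnullQ ⟨A, hAG, rfl⟩ (q '' Uᶜ)ᶜ
    (hU.isClosed_compl.isCompact.image hqc).isClosed.isOpen_compl (by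
      rintro _ ⟨a, ha, rfl⟩ ⟨u, hu, hua⟩
      rcases (hqf u a).1 hua with rfl | h
      exacts [hu (hAU ha), hu (hAU (hBA h.1))]) η hη
  have hpg : ∀ G : Set X, diam (g '' (q '' G)) < η →
      diam ((fun x => p (g (q x))) '' G) ≤ δ := by
    intro G hG
    refine diam_le_of_forall_dist_le hδ.le ?_
    rintro _ ⟨x, hx, rfl⟩ _ ⟨y, hy, rfl⟩
    refine (hpη (lt_of_le_of_lt ?_ hG)).le
    exact dist_le_diam_of_mem isBounded_of_compactSpace
      (mem_image_of_mem g (mem_image_of_mem q hx)) (mem_image_of_mem g (mem_image_of_mem q hy))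
  -- approximate the quotient map by a homeomorphism
  obtain ⟨V₂, hV₂, hBV₂, -, hV₂U, hV₂G⟩ := hnhd univ isOpen_univ (subset_univ B) _
    (hnull.finite_le_diam_image (p.continuous.comp hqc) (show 0 < 7 * δ by positivity))
    fun G hG => hG.1
  obtain ⟨ξ, hξ, hgξ⟩ := Metric.uniformContinuous_iff.1
    (CompactSpace.uniformContinuous_of_continuous (p.continuous.comp g.continuous)) δ hδ
  obtain ⟨ψ, hψ, hψV₂⟩ := happrox V₂ hV₂ hBV₂ ξ hξ
  have hdist : ∀ x, dist (p (g (ψ x))) (p (g (q x))) ≤ δ := fun x => by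
    rw [dist_comm]
    exact (hgξ (hψ x)).le
  have hsmall : ∀ G : Set X, diam (g '' (q '' G)) < η →
      diam ((fun x => p (g (ψ x))) '' G) < δ₀ := by
    intro G hG
    have h1 := diam_image_le_of_dist_le hδ.le hdist G
    have h2 := hpg G hG
    linarith
  refine ⟨(ψ.trans g).trans p, fun x hx => ?_, hsmall A hgA, fun G hG => ?_⟩
  · have hq' : g (q x) = q x := hgU _ (by simpa using ⟨x, hx, rfl⟩)
    have : p (q x) = x := by rw [hpV₁ x fun h => hx (hV₁U h), h₀U x hx]
    simp [hψV₂ x fun h => hx (hV₂U h), hq', this]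
  · rcases eq_or_ne G A with rfl | hne
    · exact Or.inl (hsmall G hgA)
    rcases hgG _ ⟨G, hG, rfl⟩ with hd | hid
    · exact Or.inl (hsmall G hd)
    have hgq : ∀ x ∈ G, g (q x) = q x := fun x hx => hid _ (mem_image_of_mem q hx)
    by_cases hd : diam ((fun x => p (q x)) '' G) < 7 * δ
    · left
      have h1 := diam_image_le_of_dist_le hδ.le hdist G
      rw [image_congr (f := fun x => p (g (q x))) (g := fun x => p (q x))
        fun x hx => congrArg p (hgq x hx)] at h1
      exact lt_of_le_of_lt h1 (by linarith)
    · right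
      intro x hx
      have hxV : x ∉ V₂ := hV₂G G ⟨hG, not_lt.1 hd⟩ hne x hx
      have := (hpG G hG hne).resolve_left hd x hx
      simp [hψV₂ x hxV, hgq x hx, this]

theorem RecursivelySqueezable.squeezable {X : Type u} [MetricSpace X] [CompactSpace X]
    {A : Set X} (hA : RecursivelySqueezable A) : Squeezable A := by
  obtain ⟨n, F, hcpt, hmono, rfl, h0, hstep⟩ := hA
  have : ∀ i, Squeezable (F i) := fun i => by
    induction i using Fin.induction with
    | zero => exact h0
    | succ i ih => exact ih.of_quotient (hcpt _) (hmono i.castSucc_le_succ) (hstep i)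
  exact this _

end Recursive

/-- **Corollary 1.** If `𝒢` is a null upper semi-continuous decomposition of a compact
metric space `X` each of whose non-singleton elements is recursively squeezable, then
`𝒢` is strongly shrinkable, and hence the quotient map `π : X → X/𝒢` is a strong near
homeomorphism. The quotient space `X/𝒢`, with a fixed metric inducing the quotient
topology, is modelled by a compact metric space `Y` together with a continuous surjection
`π : X → Y` whose fibers are exactly the elements of `𝒢`. -/
theorem null_decomposition_recursivelySqueezable_strongly_shrinkable {X : Type u}
    {Y : Type v} [MetricSpace X] [CompactSpace X] [MetricSpace Y] [CompactSpace Y]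
    (𝒢 : Set (Set X)) (hdec : IsUSCDecomposition 𝒢) (hnull : IsNullCollection 𝒢)
    (hsq : ∀ G ∈ 𝒢, (¬ ∃ x : X, G = {x}) → RecursivelySqueezable G)
    (π : X → Y) (hπ : Continuous π) (hsurj : Function.Surjective π)
    (hfib : ∀ x y : X, π x = π y ↔ ∃ G ∈ 𝒢, x ∈ G ∧ y ∈ G) :
    SatisfiesStrongShrinkingCriterion π ∧ IsStrongNearHomeomorphism π := by
  have hfiber : ∀ G ∈ 𝒢, ∀ x ∈ G, π ⁻¹' {π x} = G := by
    intro G hG x hx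
    ext z
    rw [mem_preimage, mem_singleton_iff, hfib]
    constructor
    · rintro ⟨G', hG', hz, hx'⟩
      rwa [(hdec.2.1 x).unique ⟨hG, hx⟩ ⟨hG', hx'⟩]
    · exact fun hz => ⟨G, hG, hz, hx⟩
  have hmem : ∀ y, π ⁻¹' {y} ∈ 𝒢 := by
    intro y
    obtain ⟨x, rfl⟩ := hsurj y
    obtain ⟨G, ⟨hG, hx⟩, -⟩ := hdec.2.1 x
    rwa [hfiber G hG x hx]
  have hnull' : IsNullCollection (range fun y => π ⁻¹' {y}) := by
    refine fun ε hε => (hnull ε hε).subset ?_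
    rintro _ ⟨⟨y, rfl⟩, hd⟩
    exact ⟨hmem y, hd⟩
  have hssc : SatisfiesStrongShrinkingCriterion π :=
    satisfiesStrongShrinkingCriterion_of_squeezable hπ hsurj hnull' fun y hy =>
      (hsq _ (hmem y) fun ⟨x, hx⟩ => hy (hx ▸ subsingleton_singleton)).squeezable
  exact ⟨hssc, hssc.isStrongNearHomeomorphism hπ hsurj⟩
end

section
/- If 𝒢 is a null upper semi-continuous decomposition of a compact metric space X each of whose non-singleton elements is recursively starlike-equivalent, then 𝒢 is strongly shrinkable, and hence the quotient map π : X → X/𝒢 is a strong near homeomorphism. -/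
open Metric Set Function

universe u v

/-- An indexed family is null if only finitely many members have two points at distance `≥ ε`. -/
def NullFamily {ι : Type*} {X : Type*} [PseudoMetricSpace X] (G : ι → Set X) : Prop :=
  ∀ ε > 0, {i | ∃ a ∈ G i, ∃ b ∈ G i, ε ≤ dist a b}.Finite

/-- `A` can be made small by homeomorphisms supported near `A` that, for each member of a given
null family of compact sets disjoint from `A`, either make it small or fix it pointwise. -/
def Shrinkable {X : Type u} [MetricSpace X] (A : Set X) : Prop :=
  ∀ (ι : Type u) (G : ι → Set X), (∀ i, IsCompact (G i)) → (∀ i, Disjoint (G i) A) →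
    NullFamily G → ∀ U : Set X, IsOpen U → A ⊆ U → ∀ δ > 0,
      ∃ h : X ≃ₜ X, (∀ x ∉ U, h x = x) ∧ (∀ a ∈ A, ∀ b ∈ A, dist (h a) (h b) < δ) ∧
        ∀ i, (∀ a ∈ G i, ∀ b ∈ G i, dist (h a) (h b) < δ) ∨ ∀ x ∈ G i, h x = x

theorem NullFamily.comp_injective {ι κ X : Type*} [PseudoMetricSpace X] {G : ι → Set X}
    (hG : NullFamily G) {f : κ → ι} (hf : Injective f) : NullFamily fun k => G (f k) :=
  fun ε hε => (hG ε hε).preimage (f := f) hf.injOn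

theorem NullFamily.image {ι X Y : Type*} [PseudoMetricSpace X] [PseudoMetricSpace Y]
    {G : ι → Set X} (hG : NullFamily G) {f : X → Y} (hf : UniformContinuous f) :
    NullFamily fun i => f '' G i := by
  intro ε hε
  obtain ⟨δ, hδ, h⟩ := Metric.uniformContinuous_iff.1 hf ε hε
  refine (hG δ hδ).subset ?_
  rintro i ⟨_, ⟨a, ha, rfl⟩, _, ⟨b, hb, rfl⟩, hab⟩
  refine ⟨a, ha, b, hb, ?_⟩
  by_contra hlt
  exact absurd (h (not_le.1 hlt)) (not_lt.2 hab)

/-- Bing's shrinking theorem for maps of compact metric spaces, relative to a set `P`. -/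
theorem exists_homeomorph_near_of_shrinking {X Y : Type*} [MetricSpace X] [CompactSpace X]
    [MetricSpace Y] [CompactSpace Y] {π : X → Y} (hπ : Continuous π)
    (hsurj : Surjective π) (P : Set X)
    (hshrink : ∀ δ > 0, ∃ h : X ≃ₜ X, (∀ a b, π a = π b → dist (h a) (h b) < δ) ∧
      (∀ x, dist (π x) (π (h.symm x)) < δ) ∧ ∀ x ∈ P, h x = x)
    {ε : ℝ} (hε : 0 < ε) :
    ∃ f : X ≃ₜ Y, (∀ x, dist (π x) (f x) < ε) ∧ ∀ x ∈ P, f x = π x := by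
  set p : C(X, Y) := ⟨π, hπ⟩
  set T : Set C(X, Y) := {f | ∃ g : X ≃ₜ X, (∀ x ∈ P, g x = x) ∧ ∀ x, f x = π (g x)}
  have hpT : p ∈ T := ⟨Homeomorph.refl X, fun _ _ => rfl, fun _ => rfl⟩
  set E : Set C(X, Y) := closure T
  have : CompleteSpace E := isClosed_closure.completeSpace_coe
  let O : ℕ → Set C(X, Y) := fun n => {f | ∀ a b, f a = f b → dist a b < 1 / ((n : ℝ) + 1)}
  have hO : ∀ n, IsOpen (O n) := by
    intro n
    rw [← isClosed_compl_iff]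
    have hc : IsClosed ({q : C(X, Y) × (X × X) | q.1 q.2.1 = q.1 q.2.2} ∩
        {q : C(X, Y) × (X × X) | 1 / ((n : ℝ) + 1) ≤ dist q.2.1 q.2.2}) :=
      (isClosed_eq (by fun_prop) (by fun_prop)).inter (isClosed_le (by fun_prop) (by fun_prop))
    convert isClosedMap_fst_of_compactSpace _ hc using 1
    ext f
    simp [O]
  have hdense : ∀ n, Dense {f : E | (f : C(X, Y)) ∈ O n} := by
    intro n
    rw [Metric.dense_iff]
    rintro ⟨f, hf⟩ r hr
    obtain ⟨f₁, ⟨g, hgP, hg⟩, hf₁⟩ := Metric.mem_closure_iff.1 hf (r / 2) (by positivity)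
    obtain ⟨δ, hδ, hδg⟩ := Metric.uniformContinuous_iff.1
      (CompactSpace.uniformContinuous_of_continuous g.symm.continuous) (1 / ((n : ℝ) + 1))
      (by positivity)
    obtain ⟨h, h₁, h₂, h₃⟩ := hshrink (min δ (r / 4)) (by positivity)
    let f₂ : C(X, Y) := ⟨fun x => π (h.symm (g x)), by fun_prop⟩
    have hf₂ : f₂ ∈ T := by
      refine ⟨g.trans h.symm, fun x hx => ?_, fun x => rfl⟩
      simp only [Homeomorph.trans_apply, hgP x hx]
      rw [Homeomorph.symm_apply_eq, h₃ x hx]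
    refine ⟨⟨f₂, subset_closure hf₂⟩, ?_, ?_⟩
    · have h12 : dist f₂ f₁ ≤ r / 4 := by
        rw [ContinuousMap.dist_le (by positivity)]
        intro x
        rw [hg, dist_comm]
        exact ((h₂ (g x)).trans_le (min_le_right _ _)).le
      rw [mem_ball, Subtype.dist_eq]
      calc dist f₂ f ≤ dist f₂ f₁ + dist f₁ f := dist_triangle _ _ _
        _ < r := by rw [dist_comm f₁ f]; linarith
    · intro a b hab
      have := (h₁ (h.symm (g a)) (h.symm (g b)) hab).trans_le (min_le_left _ _)
      rw [h.apply_symm_apply, h.apply_symm_apply] at this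
      simpa only [g.symm_apply_apply] using hδg this
  obtain ⟨⟨f, hfE⟩, hfO, hfp⟩ := (dense_iInter_of_isOpen_nat
    (fun n => (hO n).preimage continuous_subtype_val) hdense).exists_dist_lt
      (⟨p, subset_closure hpT⟩ : E) hε
  have hinj : Injective f := by
    intro a b hab
    by_contra hne
    obtain ⟨n, hn⟩ := exists_nat_one_div_lt (dist_pos.2 hne)
    exact absurd (mem_iInter.1 hfO n a b hab) (not_lt.2 hn.le)
  have hP : ∀ x ∈ P, f x = π x := by
    have hcl : IsClosed {f : C(X, Y) | ∀ x ∈ P, f x = π x} := by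
      simp only [Set.ofPred_forall]
      exact isClosed_biInter fun x _ => isClosed_eq (by fun_prop) continuous_const
    refine closure_minimal ?_ hcl hfE
    rintro f ⟨g, hgP, hg⟩ x hx
    rw [hg, hgP x hx]
  have hsur : Surjective f := by
    intro y
    have hcl : IsClosed {f : C(X, Y) | ∃ x, f x = y} := by
      have hc : IsClosed {q : C(X, Y) × X | q.1 q.2 = y} :=
        isClosed_eq (by fun_prop) continuous_const
      convert isClosedMap_fst_of_compactSpace _ hc using 1
      ext f
      simp
    refine closure_minimal ?_ hcl hfE
    rintro f ⟨g, -, hg⟩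
    obtain ⟨x, rfl⟩ := hsurj y
    exact ⟨g.symm x, by simp [hg]⟩
  refine ⟨Continuous.homeoOfEquivCompactToT2 (f := Equiv.ofBijective f ⟨hinj, hsur⟩)
    f.continuous, fun x => ?_, hP⟩
  exact (ContinuousMap.dist_apply_le_dist (f := p) (g := f) x).trans_lt hfp

/-- Members of a null family lying close to the zero set of `ψ` are small. -/
theorem NullFamily.eventually_small {ι X : Type*} [MetricSpace X] {G : ι → Set X}
    (hG : NullFamily G) (hc : ∀ i, IsCompact (G i)) {ψ : X → ℝ} (hψ : Continuous ψ)
    (hpos : ∀ i, ∀ x ∈ G i, 0 < ψ x) {ε : ℝ} (hε : 0 < ε) :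
    ∀ᶠ b in nhdsWithin (0 : ℝ) (Ioi 0), ∀ i, ∀ x ∈ G i, ψ x < b →
      ∀ y ∈ G i, ∀ z ∈ G i, dist y z < ε := by
  have h : ∀ᶠ b in nhdsWithin (0 : ℝ) (Ioi 0),
      ∀ i ∈ {i | ∃ a ∈ G i, ∃ b ∈ G i, ε ≤ dist a b}, ∀ x ∈ G i, b ≤ ψ x := by
    rw [Filter.eventually_all_finite (hG ε hε)]
    rintro i ⟨a, ha, -⟩
    obtain ⟨m, hm, hmin⟩ := (hc i).exists_isMinOn ⟨a, ha⟩ hψ.continuousOn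
    filter_upwards [Ioo_mem_nhdsGT (hpos i m hm)] with b hb x hx
    exact hb.2.le.trans (hmin hx)
  filter_upwards [h] with b hb i x hx hxb y hy z hz
  by_contra hlt
  exact absurd (hb i ⟨y, hy, z, hz, not_lt.1 hlt⟩ x hx) (not_le.2 hxb)

theorem NullFamily.eventually_lt {ι X : Type*} [MetricSpace X] [CompactSpace X] {G : ι → Set X}
    (hG : NullFamily G) (hc : ∀ i, IsCompact (G i)) {ψ : X → ℝ} (hψ : Continuous ψ)
    (hpos : ∀ i, ∀ x ∈ G i, 0 < ψ x) {b : ℝ} (hb : 0 < b) :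
    ∀ᶠ b' in nhdsWithin (0 : ℝ) (Ioi 0), ∀ i, ∀ x ∈ G i, ψ x < b' → ∀ y ∈ G i, ψ y < b := by
  obtain ⟨δ, hδ, hψδ⟩ := Metric.uniformContinuous_iff.1
    (CompactSpace.uniformContinuous_of_continuous hψ) (b / 2) (by positivity)
  filter_upwards [hG.eventually_small hc hψ hpos hδ, Ioo_mem_nhdsGT (half_pos hb)]
    with b' h hb' i x hx hxb y hy
  have := hψδ (h i x hx hxb x hx y hy)
  rw [Real.dist_eq] at this
  linarith [(abs_lt.1 this).1, hb'.2]

/-- An antitone step-like reparametrization whose oscillation on each `G i` is at most `1`. -/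
theorem NullFamily.exists_antitone_layering {ι X : Type*} [MetricSpace X] [CompactSpace X]
    {G : ι → Set X} (hG : NullFamily G) (hc : ∀ i, IsCompact (G i)) {ψ : X → ℝ}
    (hψ : Continuous ψ) (hpos : ∀ i, ∀ x ∈ G i, 0 < ψ x) {a : ℝ} (ha : 0 < a) (N : ℕ) :
    ∃ τ : ℝ → ℝ, Continuous τ ∧ Antitone τ ∧ (∀ s, a ≤ s → τ s = 0) ∧
      (∃ b > 0, b ≤ a ∧ ∀ s ≤ b, τ s = N) ∧
      ∀ i, ∀ x ∈ G i, ∀ y ∈ G i, |τ (ψ x) - τ (ψ y)| ≤ 1 := by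
  induction N with
  | zero => exact ⟨fun _ => 0, continuous_const, antitone_const, fun _ _ => rfl,
      ⟨a, ha, le_rfl, fun _ _ => by simp⟩, fun _ _ _ _ _ => by simp⟩
  | succ N ih =>
    obtain ⟨τ, hτc, hτa, hτ0, ⟨b, hb, hba, hτb⟩, hosc⟩ := ih
    obtain ⟨b', hb', hb'0, hb'b⟩ := ((hG.eventually_lt hc hψ hpos hb).and
      (Ioo_mem_nhdsGT hb)).exists
    let θ : ℝ → ℝ := fun s => max 0 (min 1 (2 - 2 * s / b'))
    have hθa : Antitone θ := by
      intro s t hst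
      have : 2 * s / b' ≤ 2 * t / b' := by gcongr
      simp only [θ]
      gcongr
    have hθ0 : ∀ s, b' ≤ s → θ s = 0 := by
      intro s hs
      have : 1 ≤ s / b' := (one_le_div hb'0).2 hs
      have h2 : 2 * s / b' = 2 * (s / b') := by ring
      exact max_eq_left ((min_le_right _ _).trans (by linarith))
    have hθ1 : ∀ s ≤ b' / 2, θ s = 1 := by
      intro s hs
      have h2 : 2 * s / b' ≤ 1 := (div_le_one hb'0).2 (by linarith)
      simp only [θ]
      rw [min_eq_left (by linarith), max_eq_right zero_le_one]
    have hθm : ∀ s, θ s ∈ Icc (0 : ℝ) 1 := fun s =>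
      ⟨le_max_left _ _, max_le zero_le_one (min_le_left _ _)⟩
    refine ⟨fun s => τ s + θ s, by fun_prop, hτa.add hθa, fun s hs => ?_,
      ⟨b' / 2, by positivity, by linarith, fun s hs => ?_⟩, fun i x hx y hy => ?_⟩
    · simp [hτ0 s hs, hθ0 s (by linarith)]
    · simp [hτb s (by linarith), hθ1 s hs]
    · by_cases hmeet : ∃ z ∈ G i, ψ z < b'
      · obtain ⟨z, hz, hzb⟩ := hmeet
        have hx' := hb' i z hz hzb x hx
        have hy' := hb' i z hz hzb y hy
        have h1 := hθm (ψ x)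
        have h2 := hθm (ψ y)
        simp only [hτb _ hx'.le, hτb _ hy'.le]
        rw [abs_le]
        constructor <;> linarith [h1.1, h1.2, h2.1, h2.2]
      · push Not at hmeet
        simpa [hθ0 _ (hmeet x hx), hθ0 _ (hmeet y hy)] using hosc i x hx y hy

/-- A continuous function vanishing exactly on a closed set starlike about `0`, and monotone
along rays. -/
theorem exists_radially_monotone_of_starlike {E : Type*} [NormedAddCommGroup E]
    [NormedSpace ℝ E] {S : Set E} (h0 : (0 : E) ∈ S) (hS : ∀ y ∈ S, segment ℝ 0 y ⊆ S) :
    ∃ ψ : E → ℝ, Continuous ψ ∧ (∀ x, infDist x S ≤ ψ x) ∧ (∀ x ∈ S, ψ x = 0) ∧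
      ∀ x, ∀ s ∈ Icc (0 : ℝ) 1, ψ (s • x) ≤ ψ x := by
  let ψ : E → ℝ := fun x => ⨆ s : Icc (0 : ℝ) 1, infDist ((s : ℝ) • x) S
  have hbdd : ∀ x, BddAbove (range fun s : Icc (0 : ℝ) 1 => infDist ((s : ℝ) • x) S) := by
    intro x
    refine ⟨‖x‖, ?_⟩
    rintro _ ⟨⟨s, hs0, hs1⟩, rfl⟩
    refine (infDist_le_dist_of_mem h0).trans ?_
    rw [dist_zero_right, norm_smul, Real.norm_of_nonneg hs0]
    exact mul_le_of_le_one_left (norm_nonneg _) hs1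
  have hle : ∀ x, ∀ s ∈ Icc (0 : ℝ) 1, infDist (s • x) S ≤ ψ x := fun x s hs =>
    le_ciSup (hbdd x) ⟨s, hs⟩
  have : Nonempty (Icc (0 : ℝ) 1) := ⟨⟨0, by simp⟩⟩
  refine ⟨ψ, ?_, fun x => ?_, fun x hx => ?_, fun x s hs => ?_⟩
  · refine (LipschitzWith.of_le_add fun x y => ciSup_le ?_).continuous
    rintro ⟨s, hs⟩
    refine infDist_le_infDist_add_dist (y := s • y) |>.trans ?_
    refine add_le_add (hle y s hs) ?_
    rw [dist_smul₀, Real.norm_of_nonneg hs.1]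
    exact mul_le_of_le_one_left dist_nonneg hs.2
  · simpa using hle x 1 (by simp)
  · refine le_antisymm (ciSup_le ?_) ?_
    · rintro ⟨s, hs⟩
      refine (infDist_zero_of_mem (hS x hx ?_)).le
      exact ⟨1 - s, s, by linarith [hs.2], hs.1, by ring, by simp⟩
    · exact infDist_nonneg.trans (hle x 1 (by simp))
  · refine ciSup_le ?_
    rintro ⟨r, hr⟩
    rw [smul_smul]
    exact hle x (r * s) ⟨mul_nonneg hr.1 hs.1, mul_le_one₀ hr.2 hs.1 hs.2⟩

/-- Radial contraction by a factor `exp (-t x)` that weakens outwards is bijective. -/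
theorem bijective_exp_neg_smul {E : Type*} [NormedAddCommGroup E] [NormedSpace ℝ E]
    {t : E → ℝ} (ht : Continuous t) (ht0 : ∀ x, 0 ≤ t x)
    (hray : ∀ x, ∀ s ∈ Icc (0 : ℝ) 1, t x ≤ t (s • x))
    {R : ℝ} (hR : ∀ x, R ≤ ‖x‖ → t x = 0) :
    Bijective fun x => Real.exp (-t x) • x := by
  have key : ∀ x y, t y ≤ t x → Real.exp (-t x) • x = Real.exp (-t y) • y → x = y := by
    intro x y hxy h
    have hy : y = Real.exp (t y - t x) • x := by
      have := congrArg (fun z => Real.exp (t y) • z) h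
      simp only [smul_smul, ← Real.exp_add] at this
      rw [add_neg_cancel, Real.exp_zero, one_smul] at this
      exact this.symm.trans (by rw [sub_eq_add_neg])
    have hs : Real.exp (t y - t x) ∈ Icc (0 : ℝ) 1 :=
      ⟨(Real.exp_pos _).le, Real.exp_le_one_iff.2 (by linarith)⟩
    have h1 := hray x _ hs
    rw [← hy] at h1
    rw [hy, le_antisymm hxy h1]
    simp
  constructor
  · intro x y h
    rcases le_total (t y) (t x) with hxy | hxy
    · exact key x y hxy h
    · exact (key y x hxy h.symm).symm
  · intro y
    rcases eq_or_ne y 0 with rfl | hy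
    · exact ⟨0, by simp⟩
    have hy' : 0 < ‖y‖ := norm_pos_iff.2 hy
    let r₁ : ℝ := max 1 (R / ‖y‖)
    have hr₁ : t (r₁ • y) = 0 := by
      apply hR
      rw [norm_smul, Real.norm_of_nonneg (zero_le_one.trans (le_max_left _ _))]
      exact (div_le_iff₀ hy').1 (le_max_right _ _)
    have hcont : Continuous fun r : ℝ => Real.exp (-t (r • y)) * r := by fun_prop
    obtain ⟨r, -, hr⟩ := intermediate_value_Icc (le_max_left 1 (R / ‖y‖)) hcont.continuousOn
      (show (1 : ℝ) ∈ _ by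
        refine ⟨?_, ?_⟩
        · simpa using ht0 y
        · change 1 ≤ Real.exp (-t (r₁ • y)) * r₁
          rw [hr₁]
          simp [r₁])
    refine ⟨r • y, ?_⟩
    simp only at hr ⊢
    rw [smul_smul, hr, one_smul]

theorem dist_exp_neg_smul_le {E : Type*} [NormedAddCommGroup E] [NormedSpace ℝ E]
    {a b : ℝ} (ha : 0 ≤ a) (hb : 0 ≤ b) (x y : E) :
    dist (Real.exp (-a) • x) (Real.exp (-b) • y) ≤ dist x y + |a - b| * ‖y‖ := by
  have h1 : dist (Real.exp (-a) • x) (Real.exp (-a) • y) ≤ dist x y := by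
    rw [dist_smul₀, Real.norm_of_nonneg (Real.exp_pos _).le]
    exact mul_le_of_le_one_left dist_nonneg (Real.exp_le_one_iff.2 (by linarith))
  have key : ∀ a b : ℝ, 0 ≤ a → a ≤ b → |Real.exp (-a) - Real.exp (-b)| ≤ |a - b| := by
    intro a b ha hab
    rw [abs_of_nonneg (sub_nonneg.2 (Real.exp_le_exp.2 (by linarith))), abs_of_nonpos
      (by linarith)]
    have e1 : Real.exp (-b) = Real.exp (-a) * Real.exp (a - b) := by
      rw [← Real.exp_add]; ring_nf
    have e2 := Real.add_one_le_exp (a - b)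
    have e3 : Real.exp (-a) ≤ 1 := Real.exp_le_one_iff.2 (by linarith)
    have e4 := Real.exp_pos (-a)
    rw [e1]
    nlinarith
  have h2 : |Real.exp (-a) - Real.exp (-b)| ≤ |a - b| := by
    rcases le_total a b with h | h
    · exact key a b ha h
    · rw [abs_sub_comm, abs_sub_comm a]
      exact key b a hb h
  calc _ ≤ _ := dist_triangle _ (Real.exp (-a) • y) _
    _ ≤ _ := by
      refine add_le_add h1 ?_
      rw [dist_eq_norm, ← sub_smul, norm_smul, Real.norm_eq_abs]
      gcongr

theorem continuous_of_continuousOn_of_eqOn_compl {X Z : Type*} [TopologicalSpace X]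
    [TopologicalSpace Z] {f g : X → Z} {W L : Set X} (hg : Continuous g) (hW : IsOpen W)
    (hf : ContinuousOn f W) (hL : IsClosed L) (hLW : L ⊆ W) (hfg : ∀ x ∉ L, f x = g x) :
    Continuous f := by
  rw [continuous_iff_continuousAt]
  intro x
  by_cases hx : x ∈ W
  · exact hf.continuousAt (hW.mem_nhds hx)
  · refine hg.continuousAt.congr ?_
    filter_upwards [hL.isOpen_compl.mem_nhds fun h => hx (hLW h)] with y hy
    exact (hfg y hy).symm

/-- Extending by the identity a bijection of `E` that fixes everything outside a compact subset
of the target of a chart. -/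
theorem exists_homeomorph_of_chart {X E : Type*} [TopologicalSpace X] [CompactSpace X] [T2Space X]
    [TopologicalSpace E] (c : OpenPartialHomeomorph X E) {H : E → E} (hH : Continuous H)
    (hbij : Bijective H) {K : Set E} (hK : IsCompact K) (hKt : K ⊆ c.target)
    (hHK : MapsTo H K K) (hid : ∀ y ∉ K, H y = y) :
    ∃ h : X ≃ₜ X, (∀ x ∈ c.source, h x = c.symm (H (c x))) ∧ ∀ x ∉ c.source, h x = x := by
  classical
  let f : X → X := fun x => if x ∈ c.source then c.symm (H (c x)) else x
  have hf1 : ∀ x ∈ c.source, f x = c.symm (H (c x)) := fun x hx => if_pos hx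
  have hf2 : ∀ x ∉ c.source, f x = x := fun x hx => if_neg hx
  have hHt : MapsTo H c.target c.target := by
    intro y hy
    by_cases hyK : y ∈ K
    · exact hKt (hHK hyK)
    · rwa [hid y hyK]
  have hfs : ∀ x ∈ c.source, f x ∈ c.source := fun x hx => by
    rw [hf1 x hx]
    exact c.map_target (hHt (c.map_source hx))
  have hcont : Continuous f := by
    have hL : IsCompact (c.symm '' K) :=
      hK.image_of_continuousOn (c.continuousOn_symm.mono hKt)
    refine continuous_of_continuousOn_of_eqOn_compl (g := id) (W := c.source) (L := c.symm '' K)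
      continuous_id c.open_source ?_ hL.isClosed ?_ ?_
    · refine ContinuousOn.congr ?_ hf1
      exact c.continuousOn_symm.comp (hH.comp_continuousOn c.continuousOn)
        fun x hx => hHt (c.map_source hx)
    · rintro _ ⟨y, hy, rfl⟩
      exact c.map_target (hKt hy)
    · intro x hx
      by_cases hxs : x ∈ c.source
      · rw [hf1 x hxs, hid, c.left_inv hxs, id]
        exact fun h => hx ⟨c x, h, c.left_inv hxs⟩
      · exact hf2 x hxs
  have hinj : Injective f := by
    intro x y hxy
    by_cases hx : x ∈ c.source <;> by_cases hy : y ∈ c.source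
    · rw [hf1 x hx, hf1 y hy] at hxy
      exact c.injOn hx hy (hbij.1 (c.symm.injOn (hHt (c.map_source hx))
        (hHt (c.map_source hy)) hxy))
    · exact absurd (hf2 y hy ▸ hxy ▸ hfs x hx) hy
    · exact absurd (hf2 x hx ▸ hxy ▸ hfs y hy) hx
    · rwa [hf2 x hx, hf2 y hy] at hxy
  have hsur : Surjective f := by
    intro x
    by_cases hx : x ∈ c.source
    · obtain ⟨y, hy⟩ := hbij.2 (c x)
      have hyt : y ∈ c.target := by
        by_cases hyK : y ∈ K
        · exact hKt hyK
        · rw [← hid y hyK, hy]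
          exact c.map_source hx
      refine ⟨c.symm y, ?_⟩
      rw [hf1 _ (c.map_target hyt), c.right_inv hyt, hy, c.left_inv hx]
    · exact ⟨x, hf2 x hx⟩
  exact ⟨Continuous.homeoOfEquivCompactToT2 (f := Equiv.ofBijective f ⟨hinj, hsur⟩) hcont,
    hf1, hf2⟩

theorem shrinkable_of_starlike_chart {X : Type u} [MetricSpace X] [CompactSpace X] {E : Type*}
    [NormedAddCommGroup E] [NormedSpace ℝ E] [ProperSpace E] {A : Set X}
    (c : OpenPartialHomeomorph X E) (hAc : A ⊆ c.source) (hSc : IsCompact (c '' A))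
    (h0 : (0 : E) ∈ c '' A) (hS : ∀ y ∈ c '' A, segment ℝ 0 y ⊆ c '' A) : Shrinkable A := by
  classical
  intro ι G hGc hGA hG U hU hAU δ hδ
  obtain ⟨ψ, hψ, hψinf, hψ0, hψray⟩ := exists_radially_monotone_of_starlike h0 hS
  obtain ⟨a, ha, hasub⟩ := hSc.exists_cthickening_subset_open
    (c.isOpen_inter_preimage_symm hU) (by
      rintro _ ⟨x, hx, rfl⟩
      exact ⟨c.map_source (hAc hx), by simpa [c.left_inv (hAc hx)] using hAU hx⟩)
  set K : Set E := {y | ψ y ≤ a} with hKdef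
  have hKsub : K ⊆ c.target ∩ c.symm ⁻¹' U := by
    intro y hy
    refine hasub ?_
    rw [mem_cthickening_iff, ENNReal.le_ofReal_iff_toReal_le (infEDist_ne_top ⟨0, h0⟩) ha.le]
    exact (hψinf y).trans hy
  have hK : IsCompact K := by
    refine (hSc.cthickening (r := a)).of_isClosed_subset (isClosed_le hψ continuous_const) ?_
    intro y hy
    rw [mem_cthickening_iff, ENNReal.le_ofReal_iff_toReal_le (infEDist_ne_top ⟨0, h0⟩) ha.le]
    exact (hψinf y).trans hy
  have hKt : K ⊆ c.target := fun y hy => (hKsub hy).1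
  have hL : IsCompact (c.symm '' K) := hK.image_of_continuousOn (c.continuousOn_symm.mono hKt)
  have hLs : c.symm '' K ⊆ c.source := by
    rintro _ ⟨y, hy, rfl⟩
    exact c.map_target (hKt hy)
  let ψX : X → ℝ := fun x => if x ∈ c.source then min (ψ (c x)) a else a
  have hψX1 : ∀ x ∈ c.source, ψX x = min (ψ (c x)) a := fun x hx => if_pos hx
  have hψX2 : ∀ x ∉ c.source, ψX x = a := fun x hx => if_neg hx
  have hψXc : Continuous ψX := by
    refine continuous_of_continuousOn_of_eqOn_compl (g := fun _ => a) (W := c.source)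
      (L := c.symm '' K) continuous_const c.open_source ?_ hL.isClosed hLs ?_
    · exact ((hψ.min continuous_const).comp_continuousOn c.continuousOn).congr hψX1
    · intro x hx
      by_cases hxs : x ∈ c.source
      · rw [hψX1 x hxs, min_eq_right]
        by_contra hlt
        exact hx ⟨c x, (not_le.1 hlt).le, c.left_inv hxs⟩
      · exact hψX2 x hxs
  have hψXlt : ∀ x, ψX x < a → x ∈ c.source ∧ ψX x = ψ (c x) ∧ c x ∈ K := by
    intro x hx
    by_cases hxs : x ∈ c.source
    · rw [hψX1 x hxs] at hx ⊢
      have : ψ (c x) < a := by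
        rcases min_lt_iff.1 hx with h | h
        · exact h
        · exact absurd h (lt_irrefl _)
      exact ⟨hxs, min_eq_left this.le, this.le⟩
    · exact absurd (hψX2 x hxs ▸ hx) (lt_irrefl _)
  have hpos : ∀ i, ∀ x ∈ G i, 0 < ψX x := by
    intro i x hx
    by_cases hxs : x ∈ c.source
    · rw [hψX1 x hxs]
      refine lt_min ?_ ha
      refine lt_of_lt_of_le ?_ (hψinf _)
      rw [← hSc.isClosed.notMem_iff_infDist_pos ⟨0, h0⟩]
      rintro ⟨z, hz, hzx⟩
      rw [c.injOn (hAc hz) hxs hzx] at hz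
      exact Set.disjoint_left.1 (hGA i) hx hz
    · rw [hψX2 x hxs]
      exact ha
  obtain ⟨δ₂, hδ₂, hsymm⟩ := Metric.uniformContinuousOn_iff.1
    (hK.uniformContinuousOn_of_continuous (c.continuousOn_symm.mono hKt)) δ hδ
  obtain ⟨δ₁, hδ₁, hcδ⟩ := Metric.uniformContinuousOn_iff.1
    (hL.uniformContinuousOn_of_continuous (c.continuousOn.mono hLs)) (δ₂ / 2) (by positivity)
  obtain ⟨R, hRpos, hR⟩ := hK.isBounded.exists_pos_norm_le
  obtain ⟨a', ⟨hsmall, hlt⟩, ha'0, ha'a⟩ :=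
    (((hG.eventually_small hGc hψXc hpos hδ₁).and (hG.eventually_lt hGc hψXc hpos ha)).and
      (Ioo_mem_nhdsGT ha)).exists
  set η : ℝ := δ₂ / (2 * R) with hη
  have hηpos : 0 < η := by positivity
  have hηR : η * R = δ₂ / 2 := by rw [hη]; field_simp
  obtain ⟨N, hN⟩ : ∃ N : ℕ, Real.exp (-(η * N)) * (2 * R) < δ₂ := by
    have h1 : Filter.Tendsto (fun N : ℕ => Real.exp (-(η * N)) * (2 * R)) Filter.atTop
        (nhds (0 * (2 * R))) := by
      refine (Real.tendsto_exp_neg_atTop_nhds_zero.comp ?_).mul_const _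
      exact tendsto_natCast_atTop_atTop.const_mul_atTop hηpos
    rw [zero_mul] at h1
    exact (h1.eventually_lt_const hδ₂).exists
  obtain ⟨τ, hτc, hτa, hτ0, ⟨b, hb, hba, hτb⟩, hosc⟩ :=
    hG.exists_antitone_layering hGc hψXc hpos ha'0 N
  have hτnn : ∀ s, 0 ≤ τ s := fun s =>
    (hτ0 (max s a') (le_max_right _ _)) ▸ hτa (le_max_left _ _)
  have htnn : ∀ y, 0 ≤ η * τ (ψ y) := fun y => mul_nonneg hηpos.le (hτnn _)
  have hHK : ∀ y, ψ (Real.exp (-(η * τ (ψ y))) • y) ≤ ψ y := fun y =>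
    hψray y _ ⟨(Real.exp_pos _).le, Real.exp_le_one_iff.2 (by linarith [htnn y])⟩
  have hzero : ∀ y, a' ≤ ψ y → Real.exp (-(η * τ (ψ y))) • y = y := fun y hy => by
    simp [hτ0 _ hy]
  obtain ⟨h, hh1, hh2⟩ := exists_homeomorph_of_chart c
    (H := fun y => Real.exp (-(η * τ (ψ y))) • y) (by fun_prop)
    (bijective_exp_neg_smul (t := fun y => η * τ (ψ y)) (by fun_prop) htnn
      (fun y s hs => mul_le_mul_of_nonneg_left (hτa (hψray y s hs)) hηpos.le) (R := R + 1)
      fun y hy => by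
        rw [hτ0, mul_zero]
        by_contra hlt
        have := hR y (show ψ y ≤ a by linarith)
        linarith)
    hK hKt (fun y hy => (hHK y).trans hy)
    (fun y hy => hzero y (by linarith [not_le.1 (show ¬ ψ y ≤ a from hy)]))
  have hfix : ∀ x, a' ≤ ψX x → h x = x := by
    intro x hx
    by_cases hxs : x ∈ c.source
    · rw [hh1 x hxs, hzero, c.left_inv hxs]
      rw [hψX1 x hxs] at hx
      exact hx.trans (min_le_left _ _)
    · exact hh2 x hxs
  have hdist : ∀ x y, ψX x < a → ψX y < a →
      dist (Real.exp (-(η * τ (ψ (c x)))) • c x) (Real.exp (-(η * τ (ψ (c y)))) • c y) < δ₂ →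
      dist (h x) (h y) < δ := by
    intro x y hx hy hxy
    obtain ⟨hxs, -, hxK⟩ := hψXlt x hx
    obtain ⟨hys, -, hyK⟩ := hψXlt y hy
    rw [hh1 x hxs, hh1 y hys]
    exact hsymm _ ((hHK _).trans hxK) _ ((hHK _).trans hyK) hxy
  refine ⟨h, fun x hx => ?_, fun x hx y hy => ?_, fun i => ?_⟩
  · refine hfix x (le_of_not_gt fun hlt => hx ?_)
    obtain ⟨hxs, -, hxK⟩ := hψXlt x (hlt.trans ha'a)
    simpa [c.left_inv hxs] using (hKsub hxK).2
  · have hA : ∀ z ∈ A, ψX z < a ∧ ψ (c z) = 0 := by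
      intro z hz
      have hz0 := hψ0 _ (mem_image_of_mem c hz)
      refine ⟨?_, hz0⟩
      rw [hψX1 z (hAc hz), hz0]
      exact (min_le_left _ _).trans_lt ha
    refine hdist x y (hA x hx).1 (hA y hy).1 ?_
    rw [(hA x hx).2, (hA y hy).2, hτb 0 hb.le, dist_smul₀, Real.norm_of_nonneg (Real.exp_pos _).le]
    refine lt_of_le_of_lt ?_ hN
    gcongr
    rw [dist_eq_norm]
    have h1 := hR _ (hψXlt x (hA x hx).1).2.2
    have h2 := hR _ (hψXlt y (hA y hy).1).2.2
    linarith [norm_sub_le (c x) (c y)]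
  · by_cases hmeet : ∃ z ∈ G i, ψX z < a'
    · left
      obtain ⟨z, hz, hza⟩ := hmeet
      intro x hx y hy
      have hxa := hlt i z hz hza x hx
      have hya := hlt i z hz hza y hy
      obtain ⟨hxs, hxψ, hxK⟩ := hψXlt x hxa
      obtain ⟨hys, hyψ, hyK⟩ := hψXlt y hya
      refine hdist x y hxa hya ?_
      refine (dist_exp_neg_smul_le (htnn _) (htnn _) _ _).trans_lt ?_
      have h1 : dist (c x) (c y) < δ₂ / 2 :=
        hcδ x ⟨_, hxK, c.left_inv hxs⟩ y ⟨_, hyK, c.left_inv hys⟩ (hsmall i z hz hza x hx y hy)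
      have h2 : |η * τ (ψ (c x)) - η * τ (ψ (c y))| * ‖c y‖ ≤ η * R := by
        rw [← mul_sub, abs_mul, abs_of_pos hηpos, ← hxψ, ← hyψ]
        have := hosc i x hx y hy
        have h3 := hR _ hyK
        calc η * |τ (ψX x) - τ (ψX y)| * ‖c y‖ ≤ η * 1 * R := by gcongr
          _ = η * R := by ring
      linarith
    · right
      push Not at hmeet
      exact fun x hx => hfix x (hmeet x hx)

theorem IsStarlikeEquivalent.shrinkable {X : Type u} [MetricSpace X] [CompactSpace X] {A : Set X}
    (hA : IsStarlikeEquivalent A) : Shrinkable A := by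
  obtain ⟨n, -, U, hU, hAU, e, he, heo, hcpt, x₀, ⟨z₀, hz₀, hx₀⟩, hseg⟩ := hA
  have : Nonempty U := ⟨z₀⟩
  let e' := (Topology.IsOpenEmbedding.mk he heo).toOpenPartialHomeomorph e
  let i' := hU.isOpenEmbedding_subtypeVal.toOpenPartialHomeomorph (Subtype.val : U → X)
  let c := (i'.symm.trans e').transHomeomorph (Homeomorph.subRight x₀)
  have hi : ∀ x : U, i'.symm (x : X) = x := fun x =>
    hU.isOpenEmbedding_subtypeVal.toOpenPartialHomeomorph_left_inv _
  have hsource : c.source = U := by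
    simp [c, i', e']
  have hc : ∀ x : U, c x = e x - x₀ := by
    intro x
    change e (i'.symm x) - x₀ = _
    rw [hi]
  have himage : c '' A = (fun y => y - x₀) '' (e '' {x : U | (x : X) ∈ A}) := by
    ext y
    constructor
    · rintro ⟨x, hx, rfl⟩
      exact ⟨_, ⟨⟨x, hAU hx⟩, hx, rfl⟩, (hc ⟨x, hAU hx⟩).symm⟩
    · rintro ⟨_, ⟨x, hx, rfl⟩, rfl⟩
      exact ⟨x, hx, hc x⟩
  refine shrinkable_of_starlike_chart c (hsource ▸ hAU) ?_ ?_ ?_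
  · rw [himage]
    exact hcpt.image (by fun_prop)
  · rw [himage]
    exact ⟨x₀, ⟨z₀, hz₀, hx₀⟩, sub_self _⟩
  · rw [himage]
    rintro _ ⟨y, hy, rfl⟩ _ ⟨s, t, hs, ht, hst, rfl⟩
    refine ⟨s • x₀ + t • y, hseg y hy ⟨s, t, hs, ht, hst, rfl⟩, ?_⟩
    have : s = 1 - t := by linarith
    subst this
    module

theorem Homeomorph.symm_apply_eq_self_of_fixed {X : Type*} [TopologicalSpace X] {h : X ≃ₜ X}
    {x : X} (hx : h x = x) : h.symm x = x :=
  h.symm_apply_eq.2 hx.symm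

theorem Homeomorph.symm_apply_mem_of_fixed_compl {X : Type*} [TopologicalSpace X] {h : X ≃ₜ X}
    {U : Set X} (hU : ∀ x ∉ U, h x = x) {x : X} (hx : x ∈ U) : h.symm x ∈ U := by
  by_contra hn
  have := hU _ hn
  rw [h.apply_symm_apply] at this
  exact hn (this ▸ hx)

/-- The quotient map collapsing a shrinkable set is a limit of homeomorphisms that agree with it
off a prescribed neighborhood. -/
theorem Shrinkable.exists_homeomorph_quotient {X : Type u} {Y : Type*} [MetricSpace X]
    [CompactSpace X] [MetricSpace Y] [CompactSpace Y] {B : Set X} (hB : Shrinkable B)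
    {π : X → Y} (hπ : Continuous π) (hsurj : Surjective π)
    (hfib : ∀ x y, π x = π y ↔ x = y ∨ (x ∈ B ∧ y ∈ B)) {U : Set X} (hU : IsOpen U)
    (hBU : B ⊆ U) {ε : ℝ} (hε : 0 < ε) :
    ∃ f : X ≃ₜ Y, (∀ x, dist (π x) (f x) < ε) ∧ ∀ x ∉ U, f x = π x := by
  refine exists_homeomorph_near_of_shrinking hπ hsurj Uᶜ (fun δ hδ => ?_) hε
  rcases B.eq_empty_or_nonempty with rfl | ⟨b, hb⟩
  · refine ⟨Homeomorph.refl X, fun x y hxy => ?_, fun x => ?_, fun x _ => rfl⟩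
    · rcases (hfib x y).1 hxy with rfl | h
      · simpa using hδ
      · exact absurd h.1 (notMem_empty _)
    · simpa using hδ
  · obtain ⟨h, h1, h2, -⟩ := hB PEmpty (fun _ => ∅) (fun i => i.elim) (fun i => i.elim)
      (fun _ _ => Set.toFinite _) (U ∩ π ⁻¹' ball (π b) (δ / 2))
      (hU.inter (isOpen_ball.preimage hπ))
      (fun x hx => ⟨hBU hx, by
        rw [mem_preimage, (hfib x b).2 (Or.inr ⟨hx, hb⟩)]
        exact mem_ball_self (by positivity)⟩) δ hδ
    refine ⟨h, fun x y hxy => ?_, fun x => ?_, fun x hx => h1 x fun hx' => hx hx'.1⟩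
    · rcases (hfib x y).1 hxy with rfl | hxy
      · simpa using hδ
      · exact h2 x hxy.1 y hxy.2
    · by_cases hx : x ∈ U ∩ π ⁻¹' ball (π b) (δ / 2)
      · have h3 := (Homeomorph.symm_apply_mem_of_fixed_compl h1 hx).2
        have h4 := hx.2
        rw [mem_preimage, mem_ball] at h3 h4
        linarith [dist_triangle_right (π x) (π (h.symm x)) (π b)]
      · rw [Homeomorph.symm_apply_eq_self_of_fixed (h1 x hx)]
        simpa using hδ

theorem NullFamily.exists_open_small {ι X : Type*} [MetricSpace X] {G : ι → Set X}
    (hG : NullFamily G) (hc : ∀ i, IsCompact (G i)) {A U : Set X} (hA : ∀ i, Disjoint (G i) A)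
    (hU : IsOpen U) (hAU : A ⊆ U) {ε : ℝ} (hε : 0 < ε) :
    ∃ V, IsOpen V ∧ A ⊆ V ∧ V ⊆ U ∧
      ∀ i, (∃ z ∈ G i, z ∈ V) → ∀ x ∈ G i, ∀ y ∈ G i, dist x y < ε := by
  refine ⟨U ∩ ⋂ i ∈ {i | ∃ a ∈ G i, ∃ b ∈ G i, ε ≤ dist a b}, (G i)ᶜ,
    hU.inter ((hG ε hε).isOpen_biInter fun i _ => (hc i).isClosed.isOpen_compl),
    subset_inter hAU (subset_iInter₂ fun i _ => (hA i).subset_compl_left), inter_subset_left, ?_⟩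
  rintro i ⟨z, hz, -, hzV⟩ x hx y hy
  by_contra hlt
  exact mem_iInter₂.1 hzV i ⟨x, hx, y, hy, not_lt.1 hlt⟩ hz

/-- If `B ⊆ A` is shrinkable and the image of `A` in the quotient `Y = X / B` is shrinkable, then
`A` is shrinkable. -/
theorem Shrinkable.of_quotient {X Y : Type u} [MetricSpace X] [CompactSpace X] [MetricSpace Y]
    [CompactSpace Y] {B A : Set X} (hB : Shrinkable B) (hBA : B ⊆ A)
    {π : X → Y} (hπ : Continuous π) (hsurj : Surjective π)
    (hfib : ∀ x y, π x = π y ↔ x = y ∨ (x ∈ B ∧ y ∈ B)) (hA : Shrinkable (π '' A)) :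
    Shrinkable A := by
  intro ι G hGc hGA hG U₀ hU₀ hAU₀ δ hδ
  obtain ⟨ε, hε, hεδ⟩ : ∃ ε > 0, 7 * ε = δ := ⟨δ / 7, by positivity, by ring⟩
  obtain ⟨U, hU, hAU, hUU₀, hsmall⟩ := hG.exists_open_small hGc hGA hU₀ hAU₀ hε
  have hBU := hBA.trans hAU
  have hsat : ∀ x y, π x = π y → x ∈ U → y ∈ U := by
    intro x y hxy hx
    rcases (hfib x y).1 hxy with rfl | h
    · exact hx
    · exact hBU h.2
  obtain ⟨h₁, h₁U, h₁B, h₁G⟩ := hB ι G hGc (fun i => (hGA i).mono_right hBA) hG U hU hBU ε hε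
  have h₁small : ∀ i, (∃ z ∈ G i, z ∈ U) → ∀ x ∈ G i, ∀ y ∈ G i, dist (h₁ x) (h₁ y) < ε := by
    intro i hi x hx y hy
    rcases h₁G i with h | h
    · exact h x hx y hy
    · rw [h x hx, h y hy]
      exact hsmall i hi x hx y hy
  obtain ⟨V, hV, hBV, hVU, hVsmall⟩ : ∃ V, IsOpen V ∧ B ⊆ V ∧ V ⊆ U ∧
      ∀ x ∈ V, ∀ y ∈ V, dist (h₁ x) (h₁ y) ≤ 2 * ε := by
    rcases B.eq_empty_or_nonempty with rfl | ⟨b, hb⟩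
    · exact ⟨∅, isOpen_empty, subset_rfl, empty_subset _, fun x hx => absurd hx (notMem_empty _)⟩
    · refine ⟨U ∩ h₁ ⁻¹' ball (h₁ b) ε, hU.inter (isOpen_ball.preimage h₁.continuous),
        fun x hx => ⟨hBU hx, h₁B x hx b hb⟩, inter_subset_left, fun x hx y hy => ?_⟩
      have h1 : dist (h₁ x) (h₁ b) < ε := hx.2
      have h2 : dist (h₁ y) (h₁ b) < ε := hy.2
      linarith [dist_triangle_right (h₁ x) (h₁ y) (h₁ b)]
  obtain ⟨k', -, hk'⟩ := hB.exists_homeomorph_quotient hπ hsurj hfib hV hBV one_pos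
  let k : X ≃ₜ Y := h₁.symm.trans k'
  have hkU : ∀ x ∉ U, k.symm (π x) = x := by
    intro x hx
    rw [Homeomorph.symm_apply_eq]
    change _ = k' (h₁.symm x)
    rw [Homeomorph.symm_apply_eq_self_of_fixed (h₁U x hx), hk' x fun h => hx (hVU h)]
  have hkdist : ∀ x, dist (k.symm (π x)) (h₁ x) ≤ 2 * ε := by
    intro x
    change dist (h₁ (k'.symm (π x))) (h₁ x) ≤ 2 * ε
    by_cases hx : x ∈ V
    · refine hVsmall _ ?_ _ hx
      by_contra hn
      have h1 := hk' _ hn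
      rw [k'.apply_symm_apply] at h1
      rcases (hfib _ _).1 h1 with h2 | h2
      · exact hn (h2 ▸ hx)
      · exact hn (hBV h2.2)
    · rw [← hk' x hx, k'.symm_apply_apply, dist_self]
      positivity
  obtain ⟨η, hη, hkη⟩ := Metric.uniformContinuous_iff.1
    (CompactSpace.uniformContinuous_of_continuous k.symm.continuous) ε hε
  have hπU : IsOpen (π '' U) := by
    have h1 : IsClosed (π '' Uᶜ) := (hU.isClosed_compl.isCompact.image hπ).isClosed
    have h2 : π '' U = (π '' Uᶜ)ᶜ := by
      ext y
      obtain ⟨x, rfl⟩ := hsurj y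
      constructor
      · rintro ⟨z, hz, hzx⟩ ⟨w, hw, hwx⟩
        exact hw (hsat z w (hzx.trans hwx.symm) hz)
      · intro hx
        by_contra hn
        exact hx ⟨x, fun h => hn ⟨x, h, rfl⟩, rfl⟩
    rw [h2]
    exact h1.isOpen_compl
  obtain ⟨g, hgU, hgA, hgG⟩ := hA ι (fun i => π '' G i) (fun i => (hGc i).image hπ)
    (fun i => by
      rw [Set.disjoint_left]
      rintro _ ⟨x, hx, rfl⟩ ⟨y, hy, hxy⟩
      rcases (hfib _ _).1 hxy with rfl | h
      · exact Set.disjoint_left.1 (hGA i) hx hy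
      · exact Set.disjoint_left.1 (hGA i) hx (hBA h.2))
    (hG.image (CompactSpace.uniformContinuous_of_continuous hπ)) (π '' U) hπU
    (image_mono hAU) η hη
  have hgsmall : ∀ i, (∃ z ∈ G i, z ∈ U) → ∀ x ∈ G i, ∀ y ∈ G i,
      dist (k.symm (g (π x))) (k.symm (g (π y))) < 5 * ε := by
    intro i hi x hx y hy
    rcases hgG i with h | h
    · exact (hkη (h _ ⟨x, hx, rfl⟩ _ ⟨y, hy, rfl⟩)).trans (by linarith)
    · rw [h _ ⟨x, hx, rfl⟩, h _ ⟨y, hy, rfl⟩]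
      have h1 := dist_triangle4_right (k.symm (π x)) (k.symm (π y)) (h₁ x) (h₁ y)
      linarith [h₁small i hi x hx y hy, hkdist x, hkdist y]
  obtain ⟨ζ, hζ, hkgζ⟩ := Metric.uniformContinuous_iff.1
    (CompactSpace.uniformContinuous_of_continuous (g.trans k.symm).continuous) ε hε
  obtain ⟨k₂, hk₂, hk₂U⟩ := hB.exists_homeomorph_quotient hπ hsurj hfib hU hBU hζ
  let h : X ≃ₜ X := (k₂.trans g).trans k.symm
  have hclose : ∀ x, dist (k.symm (g (π x))) (h x) < ε := fun x => hkgζ (hk₂ x)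
  have hhU : ∀ x ∉ U, h x = x := by
    intro x hx
    change k.symm (g (k₂ x)) = x
    rw [hk₂U x hx, hgU, hkU x hx]
    rintro ⟨z, hz, hzx⟩
    exact hx (hsat z x hzx hz)
  have hdist : ∀ x y, dist (k.symm (g (π x))) (k.symm (g (π y))) < 5 * ε →
      dist (h x) (h y) < δ := by
    intro x y hxy
    have h1 := dist_triangle4 (h x) (k.symm (g (π x))) (k.symm (g (π y))) (h y)
    linarith [hclose x, hclose y, dist_comm (h x) (k.symm (g (π x)))]
  refine ⟨h, fun x hx => hhU x fun h => hx (hUU₀ h), fun x hx y hy => hdist x y ?_, fun i => ?_⟩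
  · exact (hkη (hgA _ ⟨x, hx, rfl⟩ _ ⟨y, hy, rfl⟩)).trans (by linarith)
  · by_cases hi : ∃ z ∈ G i, z ∈ U
    · exact Or.inl fun x hx y hy => hdist x y (hgsmall i hi x hx y hy)
    · push Not at hi
      exact Or.inr fun x hx => hhU x (hi x hx)

theorem RecursivelyStarlikeEquivalent.shrinkable {X : Type u} [MetricSpace X] [CompactSpace X]
    {A : Set X} (hA : RecursivelyStarlikeEquivalent A) : Shrinkable A := by
  obtain ⟨n, F, -, hmono, rfl, h0, hF⟩ := hA
  have key : ∀ i : Fin (n + 1), Shrinkable (F i) := by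
    intro i
    induction i using Fin.induction with
    | zero => exact h0.shrinkable
    | succ i ih =>
      obtain ⟨Y, mY, π, hπ, hsurj, hfib, hstar⟩ := hF i
      have : CompactSpace Y := hsurj.compactSpace hπ
      exact ih.of_quotient (hmono i.castSucc_lt_succ.le) hπ hsurj hfib hstar.shrinkable
  exact key _

/-- Finitely many shrinkable members of a null partition can be shrunk simultaneously. -/
theorem exists_homeomorph_shrinking_finset {X : Type u} {Y : Type*} [MetricSpace X]
    [CompactSpace X] [MetricSpace Y] {ι : Type u} {G : ι → Set X}
    (hGc : ∀ i, IsCompact (G i)) (hdisj : Pairwise (Disjoint on G)) (hG : NullFamily G)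
    {π : X → Y} (hπ : Continuous π) (hconst : ∀ i, ∀ x ∈ G i, ∀ y ∈ G i, π x = π y)
    {P : Set X} (hP : IsClosed P) {δ : ℝ} (hδ : 0 < δ) (s : Finset ι)
    (hs : ∀ i ∈ s, Shrinkable (G i) ∧ Disjoint (G i) P) :
    ∃ h : X ≃ₜ X, (∀ x ∈ P, h x = x) ∧ (∀ x, dist (π x) (π (h.symm x)) < δ) ∧
      (∀ i ∈ s, ∀ x ∈ G i, ∀ y ∈ G i, dist (h x) (h y) < δ) ∧
      ∀ i, (∀ x ∈ G i, ∀ y ∈ G i, dist (h x) (h y) < δ) ∨ ∀ x ∈ G i, h x = x := by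
  classical
  induction s using Finset.induction_on with
  | empty =>
    exact ⟨Homeomorph.refl X, fun _ _ => rfl, fun x => by simpa using hδ, by simp,
      fun i => Or.inr fun _ _ => rfl⟩
  | insert j s _ ih =>
    obtain ⟨h, hhP, hhπ, hhs, hhG⟩ := ih fun i hi => hs i (Finset.mem_insert_of_mem hi)
    by_cases hj : ∀ x ∈ G j, ∀ y ∈ G j, dist (h x) (h y) < δ
    · refine ⟨h, hhP, hhπ, fun i hi => ?_, hhG⟩
      rcases Finset.mem_insert.1 hi with rfl | hi
      · exact hj
      · exact hhs i hi
    have hjid : ∀ x ∈ G j, h x = x := (hhG j).resolve_left hj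
    obtain ⟨z, hz⟩ : (G j).Nonempty := by
      by_contra hne
      rw [not_nonempty_iff_eq_empty] at hne
      exact hj (by simp [hne])
    obtain ⟨hjs, hjP⟩ := hs j (Finset.mem_insert_self j s)
    set U : Set X := (Pᶜ ∩ π ⁻¹' ball (π z) (δ / 2)) ∩
      (fun x => π (h.symm x)) ⁻¹' ball (π z) (δ / 2)
    have hU : IsOpen U := (hP.isOpen_compl.inter (isOpen_ball.preimage hπ)).inter
      (isOpen_ball.preimage (hπ.comp h.symm.continuous))
    have hjU : G j ⊆ U := by
      intro x hx
      have hxz : π x ∈ ball (π z) (δ / 2) := by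
        rw [hconst j x hx z hz]
        exact mem_ball_self (by positivity)
      refine ⟨⟨Set.disjoint_left.1 hjP hx, hxz⟩, ?_⟩
      rw [mem_preimage, Homeomorph.symm_apply_eq_self_of_fixed (hjid x hx)]
      exact hxz
    obtain ⟨g, hgU, hgj, hgG⟩ := hjs {i // i ≠ j} (fun i => h '' G i)
      (fun i => (hGc i).image h.continuous)
      (fun i => by
        have : G j = h '' G j := by
          ext x
          constructor
          · exact fun hx => ⟨x, hx, hjid x hx⟩
          · rintro ⟨y, hy, rfl⟩
            rwa [hjid y hy]
        rw [this, disjoint_image_iff h.injective]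
        exact hdisj i.2)
      ((hG.comp_injective Subtype.val_injective).image
        (CompactSpace.uniformContinuous_of_continuous h.continuous)) U hU hjU δ hδ
    have hgj' : ∀ x ∈ G j, ∀ y ∈ G j, dist (g (h x)) (g (h y)) < δ := by
      intro x hx y hy
      rw [hjid x hx, hjid y hy]
      exact hgj x hx y hy
    have hgs : ∀ i, (∀ x ∈ G i, ∀ y ∈ G i, dist (h x) (h y) < δ) →
        ∀ x ∈ G i, ∀ y ∈ G i, dist (g (h x)) (g (h y)) < δ := by
      intro i hi x hx y hy
      by_cases hij : i = j
      · subst hij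
        exact hgj' x hx y hy
      · rcases hgG ⟨i, hij⟩ with h1 | h1
        · exact h1 _ ⟨x, hx, rfl⟩ _ ⟨y, hy, rfl⟩
        · rw [h1 _ ⟨x, hx, rfl⟩, h1 _ ⟨y, hy, rfl⟩]
          exact hi x hx y hy
    refine ⟨h.trans g, fun x hx => ?_, fun x => ?_, fun i hi => ?_, fun i => ?_⟩
    · change g (h x) = x
      rw [hhP x hx, hgU x fun hxU => hxU.1.1 hx]
    · change dist (π x) (π (h.symm (g.symm x))) < δ
      by_cases hx : x ∈ U
      · have h1 := (Homeomorph.symm_apply_mem_of_fixed_compl hgU hx).2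
        have h2 := hx.1.2
        rw [mem_preimage, mem_ball] at h1 h2
        linarith [dist_triangle_right (π x) (π (h.symm (g.symm x))) (π z)]
      · rw [Homeomorph.symm_apply_eq_self_of_fixed (hgU x hx)]
        exact hhπ x
    · rcases Finset.mem_insert.1 hi with rfl | hi
      · exact hgj'
      · exact hgs i (hhs i hi)
    · rcases hhG i with h1 | h1
      · exact Or.inl (hgs i h1)
      · by_cases hij : i = j
        · subst hij
          exact Or.inl hgj'
        · rcases hgG ⟨i, hij⟩ with h2 | h2
          · exact Or.inl fun x hx y hy => h2 _ ⟨x, hx, rfl⟩ _ ⟨y, hy, rfl⟩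
          · exact Or.inr fun x hx => (h2 _ ⟨x, hx, rfl⟩).trans (h1 x hx)

/-- **Corollary 2.** If `𝒢` is a null upper semi-continuous decomposition of a compact
metric space `X` each of whose non-singleton elements is recursively starlike-equivalent,
then `𝒢` is strongly shrinkable, and hence the quotient map `π : X → X/𝒢` is a strong
near homeomorphism. The quotient space `X/𝒢`, with a fixed metric inducing the quotient
topology, is modelled by a compact metric space `Y` together with a continuous surjection
`π : X → Y` whose fibers are exactly the elements of `𝒢`. -/
theorem null_decomposition_recursivelyStarlikeEquivalent_strongly_shrinkable {X : Type u}
    {Y : Type v} [MetricSpace X] [CompactSpace X] [MetricSpace Y] [CompactSpace Y]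
    (𝒢 : Set (Set X)) (hdec : IsUSCDecomposition 𝒢) (hnull : IsNullCollection 𝒢)
    (hsq : ∀ G ∈ 𝒢, (¬ ∃ x : X, G = {x}) → RecursivelyStarlikeEquivalent G)
    (π : X → Y) (hπ : Continuous π) (hsurj : Function.Surjective π)
    (hfib : ∀ x y : X, π x = π y ↔ ∃ G ∈ 𝒢, x ∈ G ∧ y ∈ G) :
    SatisfiesStrongShrinkingCriterion π ∧ IsStrongNearHomeomorphism π := by
  have hcompact : ∀ G ∈ 𝒢, IsCompact G := fun G hG => (hdec.1 G hG).1
  have hunique : ∀ G ∈ 𝒢, ∀ G' ∈ 𝒢, ∀ x ∈ G, x ∈ G' → G = G' := fun G hG G' hG' x hx hx' =>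
    (hdec.2.1 x).unique ⟨hG, hx⟩ ⟨hG', hx'⟩
  have hnull' : NullFamily fun G : 𝒢 => (G : Set X) := by
    intro ε hε
    refine ((hnull ε hε).preimage Subtype.val_injective.injOn).subset ?_
    rintro ⟨G, hG⟩ ⟨a, ha, b, hb, hab⟩
    exact ⟨hG, hab.trans (dist_le_diam_of_mem (hcompact G hG).isBounded ha hb)⟩
  have hshrink : ∀ C : Set Y, IsClosed C → InjectsOver π C → ∀ δ > 0, ∃ h : X ≃ₜ X,
      (∀ a b, π a = π b → dist (h a) (h b) < δ) ∧
      (∀ x, dist (π x) (π (h.symm x)) < δ) ∧ ∀ x ∈ π ⁻¹' C, h x = x := by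
    intro C hC hinj δ hδ
    obtain ⟨h, hP, hπh, hlarge, hG⟩ := exists_homeomorph_shrinking_finset
      (G := fun G : 𝒢 => (G : Set X)) (fun G => hcompact G G.2)
      (fun G G' hne => Set.disjoint_left.2 fun x hx hx' =>
        hne (Subtype.ext (hunique G G.2 G' G'.2 x hx hx'))) hnull' hπ
      (fun G x hx y hy => (hfib x y).2 ⟨G, G.2, hx, hy⟩) (hC.preimage hπ) hδ
      (hnull' δ hδ).toFinset (by
        rintro ⟨G, hG⟩ hmem
        obtain ⟨a, ha, b, hb, hab⟩ := (hnull' δ hδ).mem_toFinset.1 hmem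
        have hne : a ≠ b := dist_pos.1 (hδ.trans_le hab)
        refine ⟨(hsq G hG ?_).shrinkable, Set.disjoint_left.2 fun x hx hxC => hne ?_⟩
        · rintro ⟨x, rfl⟩
          exact hne ((mem_singleton_iff.1 ha).trans (mem_singleton_iff.1 hb).symm)
        · have h1 : ∀ y ∈ G, y = x := fun y hy => by
            have hyx : π y = π x := (hfib y x).2 ⟨G, hG, hy, hx⟩
            exact hinj (by rwa [mem_preimage, hyx]) hxC hyx
          rw [h1 a ha, h1 b hb])
    refine ⟨h, fun a b hab => ?_, hπh, hP⟩
    obtain ⟨G, hG𝒢, ha, hb⟩ := (hfib a b).1 hab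
    by_cases hmem : (⟨G, hG𝒢⟩ : 𝒢) ∈ (hnull' δ hδ).toFinset
    · exact hlarge _ hmem a ha b hb
    · rcases hG ⟨G, hG𝒢⟩ with h1 | h1
      · exact h1 a ha b hb
      · rw [h1 a ha, h1 b hb]
        by_contra hlt
        exact hmem ((hnull' δ hδ).mem_toFinset.2 ⟨a, ha, b, hb, not_lt.1 hlt⟩)
  refine ⟨fun δ hδ C hC hinj => ?_, fun ε hε C hC hinj =>
    exists_homeomorph_near_of_shrinking hπ hsurj _ (hshrink C hC hinj) hε⟩
  obtain ⟨h, h1, h2, h3⟩ := hshrink C hC hinj (δ / 2) (by positivity)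
  refine ⟨h, fun y => ?_, fun x => (h2 x).trans (by linarith), h3⟩
  refine (diam_le_of_forall_dist_le (C := δ / 2) (by positivity) ?_).trans_lt (by linarith)
  rintro _ ⟨a, ha, rfl⟩ _ ⟨b, hb, rfl⟩
  exact (h1 a b (ha.trans hb.symm)).le
end
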